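/- For t ∈ ℝ define the real entire function H_t(x) := ∫_{0}^{∞} e^{t s²}·Φ(s)·cos(xs) ds. Suppose that for some t₀ ∈ ℝ the function H_{t₀} has a multiple real zero, i.e. there exists x₀ ∈ ℝ with H_{t₀}(x₀) = 0 and H_{t₀}′(x₀) = 0. Then for every t ∈ ℝ such that all zeros of H_t are real, one has t₀ ≤ t (equivalently, t₀ ≤ Λ, the de Bruijn–Newman constant). In particular, if t > Λ then all real zeros of H_t are simple. -/

import Mathlib

/-- The Jacobi theta kernel `Φ(t) := ∑_{n=1}^∞ π n² (2π n² e^{4t} − 3)·exp(5t − π n² e^{4t})`. -/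
noncomputable def jacobiPhi (t : ℝ) : ℝ :=
  ∑' n : ℕ, Real.pi * ((n : ℝ) + 1) ^ 2 *
    (2 * Real.pi * ((n : ℝ) + 1) ^ 2 * Real.exp (4 * t) - 3) *
    Real.exp (5 * t - Real.pi * ((n : ℝ) + 1) ^ 2 * Real.exp (4 * t))

/-- `H_t(x) := ∫₀^∞ e^{ts²}·Φ(s)·cos(xs) ds`, for real `x`. -/
noncomputable def Ht (t x : ℝ) : ℝ :=
  ∫ s in Set.Ioi (0 : ℝ), Real.exp (t * s ^ 2) * jacobiPhi s * Real.cos (x * s)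

/-- The entire extension of `H_t` to the complex plane
`H_t(z) := ∫₀^∞ e^{ts²}·Φ(s)·cos(zs) ds`; "all zeros of `H_t` are real" refers to the
zeros of this entire function. -/
noncomputable def HtC (t : ℝ) (z : ℂ) : ℂ :=
  ∫ s in Set.Ioi (0 : ℝ), ((Real.exp (t * s ^ 2) * jacobiPhi s : ℝ) : ℂ) *
    Complex.cos (z * s)

section Part1
open Complex Filter Topology Set Metric

theorem div_pow_entire (h g : ℂ → ℂ) (hh : Differentiable ℂ h) (u : ℂ) (n : ℕ)
    (hg : AnalyticAt ℂ g u) (hgu : g u ≠ 0) (he : ∀ᶠ z in 𝓝 u, h z = (z - u) ^ n * g z) :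
    ∃ k : ℂ → ℂ, Differentiable ℂ k ∧ k u ≠ 0 ∧ ∀ z, h z = (z - u) ^ n * k z := by
  classical
  refine ⟨fun z => if z = u then g u else h z / (z - u) ^ n, ?_, by simpa using hgu, ?_⟩
  · intro z
    by_cases hz : z = u
    · subst hz
      refine hg.differentiableAt.congr_of_eventuallyEq ?_
      filter_upwards [he] with w hw
      by_cases hwz : w = z
      · simp [hwz]
      · have : (w - z) ^ n ≠ 0 := pow_ne_zero _ (sub_ne_zero.2 hwz)
        simp [hwz, hw, this]
    · have h1 : DifferentiableAt ℂ (fun z => h z / (z - u) ^ n) z := by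
        refine (hh z).div (by fun_prop) (pow_ne_zero _ (sub_ne_zero.2 hz))
      refine h1.congr_of_eventuallyEq ?_
      filter_upwards [isOpen_ne.mem_nhds hz] with w hw
      simp [show w ≠ u from hw]
  · intro z
    by_cases hz : z = u
    · subst hz
      simpa using he.self_of_nhds
    · have : (z - u) ^ n ≠ 0 := pow_ne_zero _ (sub_ne_zero.2 hz)
      simp only [hz, if_false]
      field_simp

theorem entire_order_spec (f : ℂ → ℂ) (hf : Differentiable ℂ f) (h0 : f 0 ≠ 0) (u : ℂ) :
    ∃ k : ℂ → ℂ, Differentiable ℂ k ∧ k u ≠ 0 ∧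
      ∀ z, f z = (z - u) ^ (analyticOrderNatAt f u) * k z := by
  have hfa : AnalyticOnNhd ℂ f univ := fun z _ => hf.analyticAt z
  have hne : analyticOrderAt f u ≠ ⊤ := by
    intro h
    rw [analyticOrderAt_eq_top] at h
    exact h0 (hfa.eqOn_zero_of_preconnected_of_eventuallyEq_zero isPreconnected_univ
      (mem_univ u) h (mem_univ 0))
  have h1 := (hf.analyticAt u).analyticOrderAt_ne_top.1 hne
  obtain ⟨g, hg, hgu, he⟩ := h1
  refine div_pow_entire f g hf u _ hg hgu ?_
  filter_upwards [he] with z hz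
  simpa using hz

theorem entire_order_unique (f k : ℂ → ℂ) (hf : Differentiable ℂ f) (hk : Differentiable ℂ k)
    (u : ℂ) (n : ℕ) (hku : k u ≠ 0) (h : ∀ z, f z = (z - u) ^ n * k z) :
    analyticOrderNatAt f u = n := by
  have : analyticOrderAt f u = n := by
    rw [(hf.analyticAt u).analyticOrderAt_eq_natCast]
    exact ⟨k, hk.analyticAt u, hku, Eventually.of_forall (by simpa using h)⟩
  simp [analyticOrderNatAt, this]

theorem order_neg (f : ℂ → ℂ) (hf : Differentiable ℂ f) (h0 : f 0 ≠ 0)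
    (heven : ∀ z, f (-z) = f z) (u : ℂ) :
    analyticOrderNatAt f (-u) = analyticOrderNatAt f u := by
  obtain ⟨k, hk, hku, h⟩ := entire_order_spec f hf h0 u
  refine entire_order_unique f (fun z => (-1) ^ (analyticOrderNatAt f u) * k (-z)) hf (by fun_prop)
    _ _ (by simpa using hku) ?_
  intro z
  rw [← heven, h (-z), ← mul_assoc, ← mul_pow]
  congr 2
  ring

theorem order_conj (f : ℂ → ℂ) (hf : Differentiable ℂ f) (h0 : f 0 ≠ 0)
    (hconj : ∀ z, f (starRingEnd ℂ z) = starRingEnd ℂ (f z)) (u : ℂ) :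
    analyticOrderNatAt f (starRingEnd ℂ u) = analyticOrderNatAt f u := by
  obtain ⟨k, hk, hku, h⟩ := entire_order_spec f hf h0 u
  refine entire_order_unique f (fun z => starRingEnd ℂ (k (starRingEnd ℂ z))) hf ?_
    _ _ (by simpa using hku) ?_
  · intro z
    have := (hk (starRingEnd ℂ z)).conj_conj
    simpa [Function.comp_def] using this
  intro z
  have := hconj (starRingEnd ℂ z)
  rw [Complex.conj_conj] at this
  rw [this, h]
  simp

theorem factor_finset (f : ℂ → ℂ) (hf : Differentiable ℂ f) (h0 : f 0 ≠ 0) (S : Finset ℂ) :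
    ∃ h : ℂ → ℂ, Differentiable ℂ h ∧ (∀ u ∈ S, h u ≠ 0) ∧
      ∀ z, f z = (∏ u ∈ S, (z - u) ^ (analyticOrderNatAt f u)) * h z := by
  classical
  induction S using Finset.induction_on with
  | empty => exact ⟨f, hf, by simp, by simp⟩
  | insert u S hu ih =>
    obtain ⟨h, hh, hS, hfac⟩ := ih
    obtain ⟨k, hk, hku, hfk⟩ := entire_order_spec f hf h0 u
    have hP : Differentiable ℂ (fun z => ∏ v ∈ S, (z - v) ^ (analyticOrderNatAt f v)) := by
      fun_prop
    have hPu : ∏ v ∈ S, (u - v) ^ (analyticOrderNatAt f v) ≠ 0 := by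
      refine Finset.prod_ne_zero_iff.2 fun v hv => pow_ne_zero _ (sub_ne_zero.2 ?_)
      rintro rfl; exact hu hv
    obtain ⟨l, hl, hlu, hhl⟩ := div_pow_entire h
      (fun z => k z / ∏ v ∈ S, (z - v) ^ (analyticOrderNatAt f v)) hh u (analyticOrderNatAt f u)
      ((hk.analyticAt u).div (hP.analyticAt u) hPu) (div_ne_zero hku hPu) (by
        filter_upwards [hP.continuous.continuousAt.eventually_ne hPu] with z hz
        have h1 := hfac z
        rw [hfk z] at h1
        field_simp
        rw [h1]; ring)
    refine ⟨l, hl, ?_, ?_⟩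
    · intro v hv
      rcases Finset.mem_insert.1 hv with rfl | hv
      · exact hlu
      · intro h
        exact hS v hv (by rw [hhl, h, mul_zero])
    · intro z
      rw [Finset.prod_insert hu, hfac z, hhl z]
      ring

theorem zeros_finite (f : ℂ → ℂ) (hf : Differentiable ℂ f) (h0 : f 0 ≠ 0) (R : ℝ) :
    {z | f z = 0 ∧ z ∈ closedBall (0 : ℂ) R}.Finite := by
  by_contra hinf
  have hinf : {z | f z = 0 ∧ z ∈ closedBall (0 : ℂ) R}.Infinite := hinf
  obtain ⟨x, hx, hacc⟩ := hinf.exists_accPt_of_subset_isCompact (isCompact_closedBall (0 : ℂ) R)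
    (fun z hz => hz.2)
  have hfa : AnalyticOnNhd ℂ f univ := fun z _ => hf.analyticAt z
  rw [accPt_iff_frequently_nhdsNE] at hacc
  exact h0 (hfa.eqOn_zero_of_preconnected_of_frequently_eq_zero isPreconnected_univ
      (mem_univ x) (hacc.mono fun z hz => hz.1) (mem_univ 0))

/-- logarithm of a zero-free even function, quadratic bound -/
theorem log_bound (h : ℂ → ℂ) (hh : Differentiable ℂ h) (R A : ℝ) (hR : 0 < R) (hA : 0 < A)
    (hne : ∀ z ∈ ball (0 : ℂ) R, h z ≠ 0) (hd : deriv h 0 = 0)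
    (hb : ∀ z ∈ ball (0 : ℂ) R, ‖h z‖ ≤ ‖h 0‖ * Real.exp A) :
    ∃ L : ℂ → ℂ, (∀ z ∈ ball (0 : ℂ) R, h z = h 0 * exp (L z)) ∧
      ∀ z ∈ ball (0 : ℂ) (R / 2), ‖L z‖ ≤ 8 * A / R ^ 2 * ‖z‖ ^ 2 := by
  have hdh : Differentiable ℂ (deriv h) := hh.deriv
  have hq : DifferentiableOn ℂ (fun z => deriv h z / h z) (ball 0 R) := fun z hz =>
    ((hdh z).div (hh z) (hne z hz)).differentiableWithinAt
  obtain ⟨L0, hL0⟩ := hq.isExactOn_ball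
  have hm0 : (0 : ℂ) ∈ ball (0 : ℂ) R := by simpa using hR
  set L : ℂ → ℂ := fun z => L0 z - L0 0 with hLdef
  have hL : ∀ z ∈ ball (0 : ℂ) R, HasDerivAt L (deriv h z / h z) z := fun z hz =>
    (hL0 z hz).sub_const _
  have hLz : L 0 = 0 := by simp [L]
  have hLd : DifferentiableOn ℂ L (ball 0 R) := fun z hz =>
    (hL z hz).differentiableAt.differentiableWithinAt
  have hexp : ∀ z ∈ ball (0 : ℂ) R, h z = h 0 * exp (L z) := by
    have hc : ∀ z ∈ ball (0 : ℂ) R, HasDerivAt (fun z => h z * exp (-L z)) 0 z := by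
      intro z hz
      have h1 := (hh z).hasDerivAt.mul (hL z hz).neg.cexp
      convert! h1 using 1
      have := hne z hz
      field_simp
      ring
    intro z hz
    have h2 := (convex_ball (0 : ℂ) R).is_const_of_fderivWithin_eq_zero (𝕜 := ℂ)
      (f := fun z => h z * exp (-L z))
      (fun z hz => (hc z hz).differentiableAt.differentiableWithinAt) (by
        intro z hz
        rw [fderivWithin_of_isOpen isOpen_ball hz]
        simpa using (hc z hz).hasFDerivAt.fderiv) hz hm0
    simp only [hLz, neg_zero, exp_zero, mul_one] at h2
    rw [← h2, mul_assoc, ← exp_add]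
    simp
  refine ⟨L, hexp, ?_⟩
  have hre : MapsTo L (ball 0 R) {z | z.re ≤ A} := by
    intro z hz
    have h1 := hb z hz
    rw [hexp z hz, norm_mul, Complex.norm_exp] at h1
    have h2 : 0 < ‖h 0‖ := norm_pos_iff.2 (hne 0 hm0)
    have h3 := le_of_mul_le_mul_left h1 h2
    exact Real.exp_le_exp.1 h3
  have hsub : ball (0 : ℂ) (R / 2) ⊆ ball 0 R := ball_subset_ball (by linarith)
  have hL2 : MapsTo L (ball 0 (R / 2)) (closedBall (L 0) (2 * A)) := by
    intro z hz
    have h1 := borelCaratheodory_zero hA hLd hre hR (hsub hz) hLz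
    have hz' : ‖z‖ < R / 2 := by simpa using hz
    simp only [hLz, mem_closedBall, dist_zero_right]
    refine h1.trans ?_
    rw [div_le_iff₀ (by linarith)]
    nlinarith
  have hLd2 := hLd.mono hsub
  set K := dslope L 0 with hK
  have hK0 : K 0 = 0 := by
    simp [hK, dslope_same, (hL 0 hm0).deriv, hd]
  have hKd : DifferentiableOn ℂ K (ball 0 (R / 2)) :=
    (differentiableOn_dslope (ball_mem_nhds 0 (by linarith))).2 hLd2
  have hKb : MapsTo K (ball 0 (R / 2)) (closedBall (K 0) (2 * A / (R / 2))) := by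
    intro z hz
    rw [hK0, mem_closedBall, dist_zero_right]
    exact norm_dslope_le_div_of_mapsTo_ball hLd2 hL2 hz
  intro z hz
  by_cases hz0 : z = 0
  · simp [hz0, hLz]
  have h1 := norm_dslope_le_div_of_mapsTo_ball hKd hKb hz
  have h2 : L z = z ^ 2 * dslope K 0 z := by
    rw [dslope_of_ne _ hz0, slope_def_field, hK0, hK, dslope_of_ne _ hz0, slope_def_field, hLz]
    field_simp
    ring
  rw [h2, norm_mul, norm_pow]
  calc ‖z‖ ^ 2 * ‖dslope K 0 z‖ ≤ ‖z‖ ^ 2 * (2 * A / (R / 2) / (R / 2)) := by gcongr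
    _ = _ := by field_simp; ring

end Part1

section Part2
open Complex Filter Topology Set Metric

/-- zeros of `f` in the closed ball of radius `R` -/
noncomputable def zeroFinset (f : ℂ → ℂ) (hf : Differentiable ℂ f) (h0 : f 0 ≠ 0) (R : ℝ) :
    Finset ℂ := (zeros_finite f hf h0 R).toFinset

theorem mem_zeroFinset (f : ℂ → ℂ) (hf : Differentiable ℂ f) (h0 : f 0 ≠ 0) (R : ℝ) (z : ℂ) :
    z ∈ zeroFinset f hf h0 R ↔ f z = 0 ∧ ‖z‖ ≤ R := by
  simp [zeroFinset]

theorem approx_step (f : ℂ → ℂ) (hf : Differentiable ℂ f) (heven : ∀ z, f (-z) = f z)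
    (h0 : f 0 ≠ 0) (ε C : ℝ) (hε : 0 < ε)
    (hgr : ∀ z, ‖f z‖ ≤ C * Real.exp (ε * ‖z‖ ^ 2)) (R : ℝ) (hR : 0 < R) :
    ∀ z ∈ ball (0 : ℂ) (R / 2),
      8 * (Real.log (C / ‖f 0‖) + 4 * ε * R ^ 2) / R ^ 2 * ‖z‖ ^ 2 ≤ 1 →
      ‖f 0 * (∏ u ∈ zeroFinset f hf h0 R, (1 - z / u) ^ analyticOrderNatAt f u) - f z‖ ≤
      ‖f z‖ * (2 * (8 * (Real.log (C / ‖f 0‖) + 4 * ε * R ^ 2) / R ^ 2 * ‖z‖ ^ 2)) := by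
  set S := zeroFinset f hf h0 R with hS
  set m := analyticOrderNatAt f with hm
  have hSne : ∀ u ∈ S, u ≠ 0 := by
    rintro u hu rfl
    exact h0 ((mem_zeroFinset f hf h0 R 0).1 hu).1
  set P : ℂ → ℂ := fun z => ∏ u ∈ S, (1 - z / u) ^ m u with hP
  have hPd : Differentiable ℂ P := by
    simp only [hP, div_eq_mul_inv]
    fun_prop
  have hP0 : P 0 = 1 := by simp [hP]
  have hPeven : ∀ z, P (-z) = P z := by
    intro z
    simp only [hP]
    refine Finset.prod_bij (fun u _ => -u) ?_ ?_ ?_ ?_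
    · intro u hu
      rw [hS, mem_zeroFinset] at hu ⊢
      simpa [heven] using hu
    · intro a _ b _ h; simpa using h
    · intro u hu
      refine ⟨-u, ?_, by simp⟩
      rw [hS, mem_zeroFinset] at hu ⊢
      simpa [heven] using hu
    · intro u _
      simp only [hm, order_neg f hf h0 heven u]
      congr 1
      rw [neg_div, div_neg]
  obtain ⟨k, hk, hkS, hfk⟩ := factor_finset f hf h0 S
  set h : ℂ → ℂ := fun z => (∏ u ∈ S, (-u) ^ m u) * k z with hh
  have hhd : Differentiable ℂ h := by fun_prop
  have hfac : ∀ z, f z = P z * h z := by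
    intro z
    rw [hfk z]
    simp only [hP, hh]
    rw [← mul_assoc, ← Finset.prod_mul_distrib]
    congr 1
    refine Finset.prod_congr rfl fun u hu => ?_
    rw [← mul_pow]
    congr 1
    have := hSne u hu
    field_simp
    ring
  have hh0 : h 0 = f 0 := by rw [hfac 0, hP0, one_mul]
  have hprod : ∏ u ∈ S, (-u) ^ m u ≠ 0 :=
    Finset.prod_ne_zero_iff.2 fun u hu => pow_ne_zero _ (neg_ne_zero.2 (hSne u hu))
  have hhne : ∀ z ∈ ball (0 : ℂ) R, h z ≠ 0 := by
    intro z hz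
    by_cases hzS : z ∈ S
    · exact mul_ne_zero hprod (hkS z hzS)
    · intro hzz
      refine hzS ((mem_zeroFinset f hf h0 R z).2 ⟨by rw [hfac, hzz, mul_zero], ?_⟩)
      have : ‖z‖ < R := by simpa using hz
      exact this.le
  have hder : deriv h 0 = 0 := by
    have hev : ∀ᶠ z in 𝓝 (0 : ℂ), h (-z) = h z := by
      have : P 0 ≠ 0 := by rw [hP0]; exact one_ne_zero
      filter_upwards [hPd.continuous.continuousAt.eventually_ne this] with z hz
      have h1 := heven z
      rw [hfac, hfac z, hPeven] at h1
      exact mul_left_cancel₀ hz h1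
    have h1 : deriv (fun z => h (-z)) 0 = deriv h 0 := Filter.EventuallyEq.deriv_eq hev
    rw [deriv_comp_neg, neg_zero] at h1
    have h2 : (2 : ℂ) * deriv h 0 = 0 := by linear_combination -h1
    simpa using h2
  have hf0 : 0 < ‖f 0‖ := norm_pos_iff.2 h0
  have hC : ‖f 0‖ ≤ C := by simpa using hgr 0
  have hlog : 0 ≤ Real.log (C / ‖f 0‖) := Real.log_nonneg ((one_le_div hf0).2 hC)
  set A := Real.log (C / ‖f 0‖) + 4 * ε * R ^ 2 with hA
  have hApos : 0 < A := by positivity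
  have hAexp : C * Real.exp (ε * (2 * R) ^ 2) = ‖h 0‖ * Real.exp A := by
    rw [hA, Real.exp_add, Real.exp_log (div_pos (hf0.trans_le hC) hf0), hh0]
    field_simp
    ring_nf
  have hb2 : ∀ z ∈ closedBall (0 : ℂ) (2 * R), ‖h z‖ ≤ ‖h 0‖ * Real.exp A := by
    intro z hz
    refine Complex.norm_le_of_forall_mem_frontier_norm_le (U := ball (0 : ℂ) (2 * R))
      isBounded_ball hhd.diffContOnCl ?_ (by rwa [closure_ball _ (by positivity)])
    intro w hw
    rw [frontier_ball _ (by positivity)] at hw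
    have hw : ‖w‖ = 2 * R := by simpa using hw
    have hPw : 1 ≤ ‖P w‖ := by
      simp only [hP, norm_prod, norm_pow]
      refine Finset.prod_induction _ (fun x => 1 ≤ x) (fun a b ha hb => one_le_mul_of_one_le_of_one_le ha hb) le_rfl ?_
      intro u hu
      refine one_le_pow₀ ?_
      have hu1 : ‖u‖ ≤ R := ((mem_zeroFinset f hf h0 R u).1 hu).2
      have hu0 : 0 < ‖u‖ := norm_pos_iff.2 (hSne u hu)
      have h3 : 2 ≤ ‖w / u‖ := by
        rw [norm_div, hw, le_div_iff₀ hu0]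
        linarith
      have h4 := norm_sub_norm_le (w / u) 1
      rw [norm_sub_rev, norm_one] at h4
      linarith
    have h5 := hgr w
    rw [hfac w, norm_mul, hw, hAexp] at h5
    have := norm_nonneg (h w)
    nlinarith
  obtain ⟨L, hL1, hL2⟩ := log_bound h hhd R A hR hApos hhne hder (fun z hz => hb2 z
    (ball_subset_closedBall (ball_subset_ball (by linarith) hz)))
  intro z hz hle
  have hzR : z ∈ ball (0 : ℂ) R := ball_subset_ball (by linarith) hz
  have e1 : f 0 * P z - f z = f z * (exp (-L z) - 1) := by
    have : f z = P z * (f 0 * exp (L z)) := by rw [hfac z, hL1 z hzR, hh0]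
    have h6 : exp (L z) * exp (-L z) = 1 := by rw [← exp_add]; simp
    rw [this]
    linear_combination (-(P z) * f 0) * h6
  have hLz := hL2 z hz
  change ‖f 0 * P z - f z‖ ≤ _
  rw [e1, norm_mul]
  gcongr
  refine (Complex.norm_exp_sub_one_le (by rw [norm_neg]; linarith)).trans ?_
  rw [norm_neg]
  linarith

theorem approx_poly (f : ℂ → ℂ) (hf : Differentiable ℂ f) (heven : ∀ z, f (-z) = f z)
    (hconj : ∀ z, f (starRingEnd ℂ z) = starRingEnd ℂ (f z)) (h0 : f 0 ≠ 0)
    (hgr : ∀ ε : ℝ, 0 < ε → ∃ C : ℝ, ∀ z, ‖f z‖ ≤ C * Real.exp (ε * ‖z‖ ^ 2)) :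
    ∃ (S : ℕ → Finset ℂ) (m : ℂ → ℕ),
      (∀ n, ∀ u ∈ S n, f u = 0 ∧ u ≠ 0 ∧ starRingEnd ℂ u ∈ S n) ∧
      (∀ u, m (starRingEnd ℂ u) = m u) ∧
      TendstoLocallyUniformly (fun (n : ℕ) z => f 0 * ∏ u ∈ S n, (1 - z / u) ^ m u) f atTop := by
  refine ⟨fun n => zeroFinset f hf h0 n, analyticOrderNatAt f, ?_, order_conj f hf h0 hconj, ?_⟩
  · intro n u hu
    rw [mem_zeroFinset] at hu
    refine ⟨hu.1, ?_, ?_⟩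
    · rintro rfl; exact h0 hu.1
    · rw [mem_zeroFinset]
      simpa [hconj] using hu
  rw [tendstoLocallyUniformly_iff_forall_isCompact]
  intro K hK
  obtain ⟨r0, hr0⟩ := hK.isBounded.subset_closedBall (0 : ℂ)
  set r := max r0 1 with hr
  have hr1 : 1 ≤ r := le_max_right _ _
  have hKr : ∀ z ∈ K, ‖z‖ ≤ r := fun z hz =>
    (by simpa using hr0 hz : ‖z‖ ≤ r0).trans (le_max_left _ _)
  obtain ⟨M0, hM0⟩ := hK.exists_bound_of_continuousOn hf.continuous.continuousOn
  set M := max M0 1 with hM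
  have hM1 : 1 ≤ M := le_max_right _ _
  have hMK : ∀ z ∈ K, ‖f z‖ ≤ M := fun z hz => (hM0 z hz).trans (le_max_left _ _)
  rw [Metric.tendstoUniformlyOn_iff]
  intro η hη
  -- target: coefficient δ with δ ≤ 1 and 2 M δ < η
  set δ := min 1 (η / (4 * M)) with hδ
  have hδpos : 0 < δ := by positivity
  obtain ⟨C, hC⟩ := hgr (δ / (64 * r ^ 2)) (by positivity)
  set B := Real.log (C / ‖f 0‖) with hB
  have hlim : Tendsto (fun n : ℕ => 8 * B * r ^ 2 / (n : ℝ) ^ 2) atTop (𝓝 0) := by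
    refine Tendsto.const_div_atTop ?_ _
    exact (tendsto_pow_atTop (by norm_num)).comp tendsto_natCast_atTop_atTop
  filter_upwards [hlim.eventually (gt_mem_nhds (half_pos hδpos)),
    tendsto_natCast_atTop_atTop.eventually_gt_atTop (2 * r)] with n hn1 hn2
  intro z hz
  have hn : 0 < (n : ℝ) := by linarith
  have hzr := hKr z hz
  have hf0 : 0 < ‖f 0‖ := norm_pos_iff.2 h0
  have hCf : ‖f 0‖ ≤ C := by simpa using hC 0
  have hBn : 0 ≤ B := Real.log_nonneg ((one_le_div hf0).2 hCf)
  have hle : 8 * (B + 4 * (δ / (64 * r ^ 2)) * (n : ℝ) ^ 2) / (n : ℝ) ^ 2 * ‖z‖ ^ 2 ≤ δ := by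
    calc _ ≤ 8 * (B + 4 * (δ / (64 * r ^ 2)) * (n : ℝ) ^ 2) / (n : ℝ) ^ 2 * r ^ 2 := by gcongr
      _ = 8 * B * r ^ 2 / (n : ℝ) ^ 2 + δ / 2 := by field_simp; ring
      _ ≤ δ := by linarith
  have key := approx_step f hf heven h0 (δ / (64 * r ^ 2)) C (by positivity) hC n hn z
    (by simp; linarith) (hle.trans (min_le_left _ _))
  rw [dist_comm, dist_eq_norm]
  refine key.trans_lt ?_
  calc _ ≤ M * (2 * δ) := by
        gcongr
        exact hMK z hz
    _ ≤ M * (2 * (η / (4 * M))) := by gcongr; exact min_le_right _ _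
    _ = η / 2 := by field_simp; ring
    _ < η := by linarith

end Part2

section Part3
open Complex Filter Topology Set Metric

/-- the class of real even entire functions of order at most two, minimal type, nonzero at 0 -/
structure NiceF (f : ℂ → ℂ) : Prop where
  diff : Differentiable ℂ f
  even : ∀ z, f (-z) = f z
  conj : ∀ z, f (starRingEnd ℂ z) = starRingEnd ℂ (f z)
  ne0 : f 0 ≠ 0
  growth : ∀ ε : ℝ, 0 < ε → ∃ C : ℝ, ∀ z, ‖f z‖ ≤ C * Real.exp (ε * ‖z‖ ^ 2)

theorem factor_ineq (u z : ℂ) (a Δ : ℝ) (ha : 0 ≤ a) (hy : 0 ≤ z.im) (hu : |u.im| ≤ Δ)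
    (h : Δ ^ 2 - a ^ 2 ≤ z.im ^ 2) :
    ‖u - (z - a * I)‖ * ‖starRingEnd ℂ u - (z - a * I)‖ ≤
    ‖u - (z + a * I)‖ * ‖starRingEnd ℂ u - (z + a * I)‖ := by
  refine (sq_le_sq₀ (by positivity) (by positivity)).1 ?_
  rw [mul_pow, mul_pow]
  simp only [Complex.sq_norm, Complex.normSq_apply]
  simp
  have hb : u.im ^ 2 ≤ Δ ^ 2 := by
    rw [← sq_abs]; gcongr
  have key : 0 ≤ 8 * (z.im * a) * ((u.re - z.re) ^ 2 + z.im ^ 2 + a ^ 2 - u.im ^ 2) := by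
    have : 0 ≤ (u.re - z.re) ^ 2 + z.im ^ 2 + a ^ 2 - u.im ^ 2 := by
      nlinarith [sq_nonneg (u.re - z.re)]
    positivity
  nlinarith [key]

theorem mono_ineq (f : ℂ → ℂ) (hf : NiceF f) (Δ : ℝ) (hz : ∀ z, f z = 0 → |z.im| ≤ Δ)
    (z : ℂ) (a : ℝ) (ha : 0 ≤ a) (hy : 0 ≤ z.im) (h : Δ ^ 2 - a ^ 2 ≤ z.im ^ 2) :
    ‖f (z - a * I)‖ ≤ ‖f (z + a * I)‖ := by
  obtain ⟨S, m, hS, hm, hlim⟩ := approx_poly f hf.diff hf.even hf.conj hf.ne0 hf.growth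
  have hl : ∀ w, Tendsto (fun n => ‖f 0 * ∏ u ∈ S n, (1 - w / u) ^ m u‖) atTop (𝓝 ‖f w‖) :=
    fun w => ((tendstoLocallyUniformlyOn_univ.2 hlim).tendsto_at (mem_univ w)).norm
  refine le_of_tendsto_of_tendsto' (hl _) (hl _) fun n => ?_
  rw [norm_mul, norm_mul]
  gcongr
  refine (sq_le_sq₀ (by positivity) (by positivity)).1 ?_
  have hsq : ∀ w : ℂ, ‖∏ u ∈ S n, (1 - w / u) ^ m u‖ ^ 2 =
      ∏ u ∈ S n, (‖u - w‖ * ‖starRingEnd ℂ u - w‖ / ‖u‖ ^ 2) ^ m u := by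
    intro w
    have h1 : ∏ u ∈ S n, (1 - w / u) ^ m u =
        ∏ u ∈ S n, (1 - w / starRingEnd ℂ u) ^ m u := by
      refine Finset.prod_bij (fun u _ => starRingEnd ℂ u) ?_ ?_ ?_ ?_
      · intro u hu; exact (hS n u hu).2.2
      · intro a _ b _ h; simpa using congrArg (starRingEnd ℂ) h
      · intro u hu
        exact ⟨starRingEnd ℂ u, (hS n u hu).2.2, by simp⟩
      · intro u _
        simp [hm]
    rw [sq]
    nth_rewrite 2 [h1]
    rw [norm_prod, norm_prod, ← Finset.prod_mul_distrib]
    refine Finset.prod_congr rfl fun u hu => ?_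
    have hu0 := (hS n u hu).2.1
    have hu1 : starRingEnd ℂ u ≠ 0 := by simpa using hu0
    rw [norm_pow, norm_pow, ← mul_pow]
    congr 1
    have e1 : 1 - w / u = (u - w) / u := by field_simp
    have e2 : 1 - w / starRingEnd ℂ u = (starRingEnd ℂ u - w) / starRingEnd ℂ u := by field_simp
    rw [e1, e2, norm_div, norm_div, Complex.norm_conj]
    ring
  rw [hsq, hsq]
  gcongr ∏ u ∈ S n, (?_ / _) ^ _ with u hu
  exact factor_ineq u z a Δ ha hy (hz u (hS n u hu).1) h

theorem strip_step (f : ℂ → ℂ) (hf : NiceF f) (Δ : ℝ)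
    (hz : ∀ z, f z = 0 → |z.im| ≤ Δ) (a : ℝ) (ha : 0 < a)
    (hne : f (0 + a * I) + f (0 - a * I) ≠ 0) (z : ℂ) (hg : f (z + a * I) + f (z - a * I) = 0) :
    |z.im| ≤ √(Δ ^ 2 - a ^ 2) := by
  by_contra hcon
  push Not at hcon
  wlog hpos : 0 < z.im generalizing z with H
  · refine H (-z) ?_ (by simpa using hcon) ?_
    · rw [← hf.even, ← hf.even (-z - _), ← hg]
      ring_nf
    · have h0 : z.im ≠ 0 := by
        intro h; rw [h] at hcon; simp at hcon
        exact absurd hcon (not_lt.2 (Real.sqrt_nonneg _))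
      simp only [neg_im, Left.neg_pos_iff]
      exact lt_of_le_of_ne (not_lt.1 hpos) h0
  rw [abs_of_pos hpos] at hcon
  set D := √(Δ ^ 2 - a ^ 2) with hD
  have hD0 : 0 ≤ D := Real.sqrt_nonneg _
  have hDsq : Δ ^ 2 - a ^ 2 ≤ D ^ 2 := by
    rcases le_total 0 (Δ ^ 2 - a ^ 2) with h | h
    · rw [hD, Real.sq_sqrt h]
    · exact h.trans (sq_nonneg _)
  set U : Set ℂ := {w | D < w.im} with hU
  have hUo : IsOpen U := isOpen_lt continuous_const Complex.continuous_im
  have hUc : Convex ℝ U := convex_halfSpace_im_gt D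
  have hfne : ∀ w ∈ U, f (w + a * I) ≠ 0 := by
    intro w hw h
    have hw : D < w.im := hw
    have h1 := hz _ h
    simp at h1
    have h2 : 0 < w.im := hD0.trans_lt hw
    have h4 : (w.im + a) ^ 2 ≤ Δ ^ 2 := by
      rw [← sq_abs (w.im + a)]; gcongr
    have h5 : D ^ 2 < w.im ^ 2 := by gcongr
    nlinarith
  have hzU : z ∈ U := hcon
  have hfd := hf.diff
  set Q : ℂ → ℂ := fun w => f (w - a * I) / f (w + a * I) with hQ
  have hQd : DifferentiableOn ℂ Q U := by
    intro w hw
    refine DifferentiableAt.differentiableWithinAt ?_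
    exact DifferentiableAt.div (by fun_prop) (by fun_prop) (hfne w hw)
  have hQz : Q z = -1 := by
    have := hfne z hzU
    rw [hQ]
    field_simp
    linear_combination hg
  have hmax : IsMaxOn (norm ∘ Q) U z := by
    intro w hw
    have hw' : D < w.im := hw
    simp only [Function.comp, mem_ofPred_eq, hQz, norm_neg, norm_one]
    rw [hQ, norm_div, div_le_one (norm_pos_iff.2 (hfne w hw))]
    refine mono_ineq f hf Δ hz w a ha.le (hD0.trans hw'.le) (hDsq.trans ?_)
    gcongr
  have heq := Complex.eqOn_of_isPreconnected_of_isMaxOn_norm hUc.isPreconnected hUo hQd hzU hmax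
  have hga : AnalyticOnNhd ℂ (fun w => f (w + a * I) + f (w - a * I)) univ := by
    intro w _
    refine Differentiable.analyticAt ?_ w
    fun_prop
  refine hne (hga.eqOn_zero_of_preconnected_of_eventuallyEq_zero isPreconnected_univ
    (mem_univ z) ?_ (mem_univ 0))
  filter_upwards [hUo.mem_nhds hzU] with w hw
  have h1 := heq hw
  simp only [Function.const, hQz] at h1
  have := hfne w hw
  rw [hQ] at h1
  field_simp at h1
  simp only [Pi.zero_apply]
  linear_combination h1

theorem strip_limit (f : ℕ → ℂ → ℂ) (hf : ∀ n, NiceF (f n)) (Δ : ℝ) (hΔ : 0 ≤ Δ)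
    (hz : ∀ᶠ n in atTop, ∀ z, f n z = 0 → |z.im| ≤ Δ) (F : ℂ → ℂ) (hF : NiceF F)
    (hlim : ∀ z, Tendsto (fun n => f n z) atTop (𝓝 (F z))) (z : ℂ) (hzF : F z = 0) :
    |z.im| ≤ Δ := by
  by_contra hcon
  push Not at hcon
  wlog hpos : 0 < z.im generalizing z with H
  · refine H (-z) (by rw [hF.even, hzF]) (by simpa using hcon) ?_
    have h0 : z.im ≠ 0 := by
      intro h; rw [h] at hcon; simp at hcon
      exact absurd hcon (not_lt.2 hΔ)
    simp only [neg_im, Left.neg_pos_iff]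
    exact lt_of_le_of_ne (not_lt.1 hpos) h0
  rw [abs_of_pos hpos] at hcon
  have hmono : ∀ w : ℂ, Δ ≤ w.im → ∀ b : ℝ, 0 ≤ b → ‖F (w - b * I)‖ ≤ ‖F (w + b * I)‖ := by
    intro w hw b hb
    refine le_of_tendsto_of_tendsto (hlim _).norm (hlim _).norm ?_
    filter_upwards [hz] with n hn
    refine mono_ineq (f n) (hf n) Δ hn w b hb (hΔ.trans hw) ?_
    nlinarith [sq_nonneg b]
  have hzero : ∀ b : ℝ, 0 ≤ b → b ≤ z.im - Δ → F (z - 2 * b * I) = 0 := by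
    intro b hb hb2
    have h1 := hmono (z - b * I) (by simp; linarith) b hb
    rw [show z - b * I + b * I = z by ring, hzF, norm_zero,
      show z - b * I - b * I = z - 2 * b * I by ring] at h1
    exact norm_le_zero_iff.1 h1
  have hFa : AnalyticOnNhd ℂ F univ := fun w _ => hF.diff.analyticAt w
  refine hF.ne0 (hFa.eqOn_zero_of_preconnected_of_frequently_eq_zero isPreconnected_univ
    (mem_univ z) ?_ (mem_univ 0))
  have ht : Tendsto (fun b : ℝ => z - 2 * b * I) (𝓝[>] 0) (𝓝[≠] z) := by
    refine tendsto_nhdsWithin_iff.2 ⟨?_, ?_⟩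
    · have : Tendsto (fun b : ℝ => z - 2 * b * I) (𝓝 0) (𝓝 (z - 2 * (0 : ℝ) * I)) :=
        Continuous.tendsto (by fun_prop) 0
      simp only [ofReal_zero, mul_zero, zero_mul, sub_zero] at this
      exact this.mono_left nhdsWithin_le_nhds
    · filter_upwards [self_mem_nhdsWithin] with b hb
      have hb : (0 : ℝ) < b := hb
      intro h
      have h2 : (2 * (b : ℂ) * I) = 0 := by
        have h3 : z - 2 * b * I = z := h
        linear_combination -h3
      simp [hb.ne'] at h2
  refine ht.frequently (Eventually.frequently ?_)
  have hlt : 0 < z.im - Δ := by linarith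
  filter_upwards [self_mem_nhdsWithin, nhdsWithin_le_nhds (gt_mem_nhds hlt)] with b hb hb2
  exact hzero b (le_of_lt hb) hb2.le

open Polynomial in
theorem splits_derivative (p : ℝ[X]) (hp : p.Splits) : (derivative p).Splits := by
  by_cases h0 : p.natDegree = 0
  · rw [natDegree_eq_zero] at h0
    obtain ⟨c, rfl⟩ := h0
    simp
  rw [splits_iff_card_roots] at hp ⊢
  have h1 := card_roots_le_derivative p
  have h2 := card_roots' (derivative p)
  have h3 := natDegree_derivative_le p
  omega

open Polynomial in
theorem laguerre_split (p : ℝ[X]) (hp : p.Splits) (x : ℝ) :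
    0 ≤ (eval x (derivative p)) ^ 2 - eval x p * eval x (derivative (derivative p)) := by
  have key : ∀ s : Multiset ℝ, 0 ≤ (eval x (derivative ((s.map fun a => X - C a).prod))) ^ 2 -
      eval x ((s.map fun a => X - C a).prod) *
      eval x (derivative (derivative ((s.map fun a => X - C a).prod))) := by
    intro s
    induction s using Multiset.induction_on with
    | empty => simp
    | cons a s ih =>
      rw [Multiset.map_cons, Multiset.prod_cons]
      set q := (s.map fun a => X - C a).prod
      simp only [derivative_mul, derivative_sub, derivative_X, derivative_C, derivative_add,
        eval_add, eval_mul, eval_sub, eval_X, eval_C, sub_zero, one_mul]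
      nlinarith [sq_nonneg (eval x q), mul_nonneg (sq_nonneg (x - a)) ih]
  rw [hp.eq_prod_roots]
  have := key p.roots
  simp only [derivative_C_mul, eval_C_mul]
  nlinarith [mul_nonneg (sq_nonneg p.leadingCoeff) this]

open Polynomial in
theorem laguerre_nice (f : ℂ → ℂ) (hf : NiceF f) (hz : ∀ z, f z = 0 → z.im = 0) (k : ℕ) (x : ℝ) :
    0 ≤ ((deriv^[k + 1] f x).re) ^ 2 - (deriv^[k] f x).re * (deriv^[k + 2] f x).re := by
  obtain ⟨S, m, hS, hm, hlim⟩ := approx_poly f hf.diff hf.even hf.conj hf.ne0 hf.growth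
  set p : ℕ → ℝ[X] := fun n => C (f 0).re * ∏ u ∈ S n, (C (-1 / u.re) * X + C 1) ^ m u with hp
  have hsp : ∀ n, (p n).Splits := by
    intro n
    refine Splits.C_mul (Splits.prod fun u _ => Splits.pow (Splits.of_natDegree_le_one ?_) _) _
    exact natDegree_linear_le
  have hf0 : f 0 = ((f 0).re : ℂ) := by
    have := hf.conj 0
    rw [map_zero] at this
    exact (Complex.conj_eq_iff_re.1 this.symm).symm
  have hfun : ∀ n, (fun z => f 0 * ∏ u ∈ S n, (1 - z / u) ^ m u) =
      fun z => eval z ((p n).map ofRealHom) := by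
    intro n
    ext z
    simp only [hp, Polynomial.map_mul, eval_mul, Polynomial.map_prod, eval_prod,
      Polynomial.map_pow, eval_pow, map_C, eval_C, Polynomial.map_add, Polynomial.map_X, eval_add,
      eval_X]
    congr 1
    refine Finset.prod_congr rfl fun u hu => ?_
    have hu' : u = (u.re : ℂ) := by
      apply Complex.ext <;> simp [hz u (hS n u hu).1]
    congr 1
    simp only [ofRealHom_eq_coe, ofReal_div, ofReal_neg, ofReal_one]
    rw [← hu']
    ring
  rw [show (fun (n : ℕ) z => f 0 * ∏ u ∈ S n, (1 - z / u) ^ m u) =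
    fun (n : ℕ) z => eval z ((p n).map ofRealHom) from funext hfun] at hlim
  rw [← tendstoLocallyUniformlyOn_univ] at hlim
  have hder : ∀ j : ℕ, TendstoLocallyUniformlyOn
      (fun (n : ℕ) z => eval z (derivative^[j] ((p n).map ofRealHom))) (deriv^[j] f) atTop univ := by
    intro j
    induction j with
    | zero => exact hlim
    | succ j ih =>
      have h1 := ih.deriv (Eventually.of_forall fun n => by fun_prop) isOpen_univ
      rw [Function.iterate_succ_apply']
      refine h1.congr ?_
      intro n z _
      simp [Function.iterate_succ_apply']
  have hre : ∀ j : ℕ, Tendsto (fun n => eval x (derivative^[j] (p n))) atTop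
      (𝓝 (deriv^[j] f x).re) := by
    intro j
    have h1 := ((hder j).tendsto_at (mem_univ (x : ℂ)))
    have h2 := (Complex.continuous_re.tendsto _).comp h1
    refine h2.congr fun n => ?_
    simp only [Function.comp]
    have h3 : derivative^[j] ((p n).map ofRealHom) = (derivative^[j] (p n)).map ofRealHom := by
      rw [iterate_derivative_map]
    rw [h3]
    have h4 : eval (x : ℂ) ((derivative^[j] (p n)).map ofRealHom) =
      ((eval x (derivative^[j] (p n)) : ℝ) : ℂ) := by
      rw [eval_map]
      exact Polynomial.eval₂_at_apply ofRealHom x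
    rw [h4, ofReal_re]
  refine ge_of_tendsto' (((hre (k + 1)).pow 2).sub ((hre k).mul (hre (k + 2)))) fun n => ?_
  have hspk : ∀ j, (derivative^[j] (p n)).Splits := by
    intro j
    induction j with
    | zero => exact hsp n
    | succ j ih => rw [Function.iterate_succ_apply']; exact splits_derivative _ ih
  have := laguerre_split _ (hspk k) x
  rw [Function.iterate_succ_apply', Function.iterate_succ_apply', Function.iterate_succ_apply']
  exact this

end Part3

section Part4
open Complex Filter Topology Set Metric MeasureTheory

/-- positive continuous kernels on the half line decaying faster than every Gaussian -/
structure GoodK (ψ : ℝ → ℝ) : Prop where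
  cont : ContinuousOn ψ (Ioi 0)
  pos : ∀ s, 0 < s → 0 < ψ s
  decay : ∀ k : ℝ, ∃ C : ℝ, ∀ s, 0 < s → ψ s ≤ C * Real.exp (-k * s ^ 2)

theorem GoodK.int {ψ : ℝ → ℝ} (h : GoodK ψ) (c : ℝ) :
    IntegrableOn (fun s => ψ s * Real.exp (c * s ^ 2)) (Ioi 0) := by
  obtain ⟨C, hC⟩ := h.decay (c + 1)
  have h1 : IntegrableOn (fun s : ℝ => C * Real.exp (-1 * s ^ 2)) (Ioi 0) :=
    ((integrable_exp_neg_mul_sq one_pos).const_mul C).integrableOn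
  refine Integrable.mono' h1 ?_ ?_
  · refine ContinuousOn.aestronglyMeasurable ?_ measurableSet_Ioi
    exact h.cont.mul (by fun_prop)
  · refine (ae_restrict_iff' measurableSet_Ioi).2 (Eventually.of_forall fun s hs => ?_)
    have hp := h.pos s hs
    rw [Real.norm_of_nonneg (by positivity)]
    calc ψ s * Real.exp (c * s ^ 2) ≤ C * Real.exp (-(c + 1) * s ^ 2) * Real.exp (c * s ^ 2) := by
          gcongr; exact hC s hs
      _ = C * Real.exp (-1 * s ^ 2) := by
          rw [mul_assoc, ← Real.exp_add]; ring_nf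

theorem GoodK.int_dom {ψ : ℝ → ℝ} (h : GoodK ψ) (G : ℝ → ℂ) (hG : Continuous G) (B c : ℝ)
    (hb : ∀ s, 0 < s → ‖G s‖ ≤ B * Real.exp (c * s ^ 2)) :
    IntegrableOn (fun s => (ψ s : ℂ) * G s) (Ioi 0) := by
  refine Integrable.mono' ((h.int c).const_mul B) ?_ ?_
  · refine ContinuousOn.aestronglyMeasurable ?_ measurableSet_Ioi
    exact (Complex.continuous_ofReal.comp_continuousOn h.cont).mul hG.continuousOn
  · refine (ae_restrict_iff' measurableSet_Ioi).2 (Eventually.of_forall fun s hs => ?_)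
    have hp := h.pos s hs
    rw [norm_mul, norm_real, Real.norm_of_nonneg hp.le]
    calc ψ s * ‖G s‖ ≤ ψ s * (B * Real.exp (c * s ^ 2)) := by gcongr; exact hb s hs
      _ = _ := by ring

theorem norm_cos_le (w : ℂ) : ‖cos w‖ ≤ Real.exp ‖w‖ := by
  rw [Complex.cos]
  have h1 : ‖exp (w * I)‖ ≤ Real.exp ‖w‖ := by
    refine (norm_exp_le_exp_norm _).trans (by simp)
  have h2 : ‖exp (-w * I)‖ ≤ Real.exp ‖w‖ := by
    refine (norm_exp_le_exp_norm _).trans (by simp)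
  have h3 := norm_add_le (exp (w * I)) (exp (-w * I))
  rw [norm_div]
  simp only [Complex.norm_ofNat]
  linarith

/-- iterated derivatives of the cosine transform -/
noncomputable def GJ (ψ : ℝ → ℝ) (j : ℕ) (z : ℂ) : ℂ :=
  ∫ s in Ioi (0 : ℝ), (ψ s : ℂ) * ((s : ℂ) ^ j * cos (z * s + j * (Real.pi / 2 : ℝ)))

theorem GJ_bound (j : ℕ) (z : ℂ) (r : ℝ) (hr : ‖z‖ ≤ r) (s : ℝ) (hs : 0 < s) :
    ‖(s : ℂ) ^ j * cos (z * s + j * (Real.pi / 2 : ℝ))‖ ≤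
      Real.exp (2 * j + (j + r) ^ 2) * Real.exp (1 * s ^ 2) := by
  rw [norm_mul, norm_pow, norm_real, Real.norm_of_nonneg hs.le]
  have h1 : s ^ j ≤ Real.exp (j * s) := by
    rw [Real.exp_nat_mul]
    gcongr
    linarith [Real.add_one_le_exp s]
  have h2 : ‖cos (z * s + j * (Real.pi / 2 : ℝ))‖ ≤ Real.exp (r * s + 2 * j) := by
    refine (norm_cos_le _).trans (Real.exp_le_exp.2 ?_)
    refine (norm_add_le _ _).trans ?_
    rw [norm_mul, norm_mul, norm_real, norm_real, Real.norm_of_nonneg hs.le, Complex.norm_natCast,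
      Real.norm_of_nonneg (by positivity)]
    have h3 : Real.pi / 2 ≤ 2 := by linarith [Real.pi_le_four]
    have h4 : (j : ℝ) * (Real.pi / 2) ≤ j * 2 := by gcongr
    have h5 : ‖z‖ * s ≤ r * s := by gcongr
    linarith
  calc _ ≤ Real.exp (j * s) * Real.exp (r * s + 2 * j) := by gcongr
    _ = Real.exp (j * s + (r * s + 2 * j)) := (Real.exp_add _ _).symm
    _ ≤ Real.exp (2 * j + (j + r) ^ 2 + 1 * s ^ 2) := by
      refine Real.exp_le_exp.2 ?_
      nlinarith [sq_nonneg ((j : ℝ) + r - s), sq_nonneg ((j : ℝ) + r), sq_nonneg s]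
    _ = _ := by rw [Real.exp_add]

theorem GJ_integrable {ψ : ℝ → ℝ} (h : GoodK ψ) (j : ℕ) (z : ℂ) :
    IntegrableOn (fun s => (ψ s : ℂ) * ((s : ℂ) ^ j * cos (z * s + j * (Real.pi / 2 : ℝ))))
      (Ioi 0) :=
  h.int_dom _ (by fun_prop) _ _ (GJ_bound j z ‖z‖ le_rfl)

theorem cos_shift (j : ℕ) (w : ℂ) :
    cos (w + ((j + 1 : ℕ) : ℂ) * (Real.pi / 2 : ℝ)) = -sin (w + j * (Real.pi / 2 : ℝ)) := by
  have : w + ((j + 1 : ℕ) : ℂ) * (Real.pi / 2 : ℝ) =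
    (w + j * (Real.pi / 2 : ℝ)) + Real.pi / 2 := by push_cast; ring
  rw [this, Complex.cos_add_pi_div_two]

theorem GJ_hasDerivAt {ψ : ℝ → ℝ} (h : GoodK ψ) (j : ℕ) (z : ℂ) :
    HasDerivAt (GJ ψ j) (GJ ψ (j + 1) z) z := by
  have key := hasDerivAt_integral_of_dominated_loc_of_deriv_le (μ := volume.restrict (Ioi (0 : ℝ)))
    (F := fun z s => (ψ s : ℂ) * ((s : ℂ) ^ j * cos (z * s + j * (Real.pi / 2 : ℝ))))
    (F' := fun z s => (ψ s : ℂ) * ((s : ℂ) ^ (j + 1) *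
      cos (z * s + ((j + 1 : ℕ) : ℂ) * (Real.pi / 2 : ℝ))))
    (x₀ := z) (s := ball z 1)
    (bound := fun s => Real.exp (2 * (j + 1 : ℕ) + ((j + 1 : ℕ) + (‖z‖ + 1)) ^ 2) *
      (ψ s * Real.exp (1 * s ^ 2)))
    (ball_mem_nhds z one_pos)
    (Eventually.of_forall fun w => (GJ_integrable h j w).aestronglyMeasurable)
    (GJ_integrable h j z) (GJ_integrable h (j + 1) z).aestronglyMeasurable ?_
    ((h.int 1).const_mul _) ?_
  · exact key.2
  · refine (ae_restrict_iff' measurableSet_Ioi).2 (Eventually.of_forall fun s hs w hw => ?_)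
    have hp := h.pos s hs
    have hw' : ‖w‖ ≤ ‖z‖ + 1 := by
      have h1 : ‖w - z‖ < 1 := by simpa [dist_eq_norm] using hw
      have h2 := norm_add_le z (w - z)
      rw [add_sub_cancel] at h2
      linarith
    have := GJ_bound (j + 1) w _ hw' s hs
    rw [norm_mul, norm_real, Real.norm_of_nonneg hp.le]
    refine (mul_le_mul_of_nonneg_left this hp.le).trans (le_of_eq (by ring))
  · refine Eventually.of_forall fun s w _ => ?_
    have h1 : HasDerivAt (fun w : ℂ => w * s + j * (Real.pi / 2 : ℝ)) s w := by
      simpa using ((hasDerivAt_id w).mul_const (s : ℂ)).add_const (j * (Real.pi / 2 : ℝ) : ℂ)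
    have h2 := ((h1.ccos).const_mul ((s : ℂ) ^ j)).const_mul (ψ s : ℂ)
    convert! h2 using 1
    rw [cos_shift]
    ring

/-- cosine transform -/
noncomputable def FC (ψ : ℝ → ℝ) (z : ℂ) : ℂ :=
  ∫ s in Ioi (0 : ℝ), (ψ s : ℂ) * cos (z * s)

theorem FC_eq (ψ : ℝ → ℝ) : FC ψ = GJ ψ 0 := by
  ext z; simp [FC, GJ]

theorem FC_integrable {ψ : ℝ → ℝ} (h : GoodK ψ) (z : ℂ) :
    IntegrableOn (fun s => (ψ s : ℂ) * cos (z * s)) (Ioi 0) := by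
  simpa using GJ_integrable h 0 z

theorem FC_iter {ψ : ℝ → ℝ} (h : GoodK ψ) (k : ℕ) : deriv^[k] (FC ψ) = GJ ψ k := by
  induction k with
  | zero => exact FC_eq ψ
  | succ k ih =>
    rw [Function.iterate_succ_apply', ih]
    ext z
    exact (GJ_hasDerivAt h k z).deriv

theorem FC_nice {ψ : ℝ → ℝ} (h : GoodK ψ) : NiceF (FC ψ) where
  diff := by
    rw [FC_eq]
    exact fun z => (GJ_hasDerivAt h 0 z).differentiableAt
  even := by
    intro z
    simp [FC]
  conj := by
    intro z
    rw [FC, FC, ← integral_conj]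
    congr 1
    ext s
    simp [← Complex.cos_conj]
  ne0 := by
    have h1 : FC ψ 0 = ((∫ s in Ioi (0 : ℝ), ψ s : ℝ) : ℂ) := by
      rw [FC]
      simp only [zero_mul, Complex.cos_zero, mul_one]
      exact integral_ofReal
    rw [h1, Complex.ofReal_ne_zero]
    refine ne_of_gt ?_
    have hi : IntegrableOn ψ (Ioi 0) := by simpa using h.int 0
    rw [setIntegral_pos_iff_support_of_nonneg_ae ?_ hi]
    · refine lt_of_lt_of_le (b := volume (Ioi (0 : ℝ))) (by simp) (measure_mono ?_)
      exact fun s hs => ⟨(h.pos s hs).ne', hs⟩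
    · exact (ae_restrict_iff' measurableSet_Ioi).2 (Eventually.of_forall fun s hs => (h.pos s hs).le)
  growth := by
    intro ε hε
    refine ⟨∫ s in Ioi (0 : ℝ), ψ s * Real.exp (1 / (4 * ε) * s ^ 2), fun z => ?_⟩
    rw [FC, ← integral_mul_const]
    refine norm_integral_le_of_norm_le ((h.int _).mul_const _) ?_
    refine (ae_restrict_iff' measurableSet_Ioi).2 (Eventually.of_forall fun s hs => ?_)
    have hp := h.pos s hs
    have hs : 0 < s := hs
    rw [norm_mul, norm_real, Real.norm_of_nonneg hp.le, mul_assoc, ← Real.exp_add]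
    gcongr
    refine (norm_cos_le _).trans (Real.exp_le_exp.2 ?_)
    rw [norm_mul, norm_real, Real.norm_of_nonneg hs.le]
    have h1 : 1 / (4 * ε) * s ^ 2 + ε * ‖z‖ ^ 2 - ‖z‖ * s = ε * (‖z‖ - s / (2 * ε)) ^ 2 := by
      field_simp
      ring
    have h2 : 0 ≤ ε * (‖z‖ - s / (2 * ε)) ^ 2 := by positivity
    linarith

theorem GoodK.mul {ψ : ℝ → ℝ} (h : GoodK ψ) (g : ℝ → ℝ) (hg : Continuous g)
    (hpos : ∀ s, 0 < g s) (c : ℝ) (hb : ∀ s, g s ≤ Real.exp (c * s ^ 2)) :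
    GoodK (fun s => g s * ψ s) where
  cont := hg.continuousOn.mul h.cont
  pos s hs := mul_pos (hpos s) (h.pos s hs)
  decay k := by
    obtain ⟨C, hC⟩ := h.decay (k + c)
    refine ⟨C, fun s hs => ?_⟩
    have hp := h.pos s hs
    calc g s * ψ s ≤ Real.exp (c * s ^ 2) * (C * Real.exp (-(k + c) * s ^ 2)) := by
          gcongr
          · exact hb s
          · exact hC s hs
      _ = C * (Real.exp (c * s ^ 2) * Real.exp (-(k + c) * s ^ 2)) := by ring
      _ = _ := by rw [← Real.exp_add]; ring_nf

theorem GoodK.mul_exp {ψ : ℝ → ℝ} (h : GoodK ψ) (t : ℝ) :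
    GoodK (fun s => Real.exp (t * s ^ 2) * ψ s) :=
  h.mul _ (by fun_prop) (fun _ => Real.exp_pos _) t (fun _ => le_rfl)

theorem GoodK.mul_cosh {ψ : ℝ → ℝ} (h : GoodK ψ) (a : ℝ) :
    GoodK (fun s => Real.cosh (a * s) * ψ s) :=
  h.mul _ (by fun_prop) (fun _ => Real.cosh_pos _) (a ^ 2 / 2) (fun s => by
    refine (Real.cosh_le_exp_half_sq _).trans (le_of_eq ?_)
    ring_nf)

theorem FC_cosh {ψ : ℝ → ℝ} (h : GoodK ψ) (a : ℝ) (z : ℂ) :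
    2 * FC (fun s => Real.cosh (a * s) * ψ s) z = FC ψ (z + a * I) + FC ψ (z - a * I) := by
  rw [FC, FC, FC, ← integral_add (FC_integrable h _) (FC_integrable h _), ← integral_const_mul]
  congr 1
  ext s
  have : cos ((z + a * I) * s) + cos ((z - a * I) * s) = 2 * cosh (a * s) * cos (z * s) := by
    rw [show (z + a * I) * s = z * s + (a * s) * I by ring,
      show (z - a * I) * s = z * s - (a * s) * I by ring, Complex.cos_add, Complex.cos_sub,
      Complex.cos_mul_I]
    ring
  push_cast
  linear_combination -(ψ s : ℂ) * this

theorem FC_cosh_strip {ψ : ℝ → ℝ} (h : GoodK ψ) (a : ℝ) (ha : 0 < a) (Δ : ℝ)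
    (hz : ∀ z, FC ψ z = 0 → |z.im| ≤ Δ) (z : ℂ)
    (h0 : FC (fun s => Real.cosh (a * s) * ψ s) z = 0) : |z.im| ≤ √(Δ ^ 2 - a ^ 2) := by
  refine strip_step (FC ψ) (FC_nice h) Δ hz a ha ?_ z ?_
  · rw [← FC_cosh h]
    exact mul_ne_zero two_ne_zero (FC_nice (h.mul_cosh a)).ne0
  · rw [← FC_cosh h, h0, mul_zero]

theorem FC_cosh_pow_strip {ψ : ℝ → ℝ} (h : GoodK ψ) (a : ℝ) (ha : 0 < a) (Δ : ℝ) (hΔ : 0 ≤ Δ)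
    (hz : ∀ z, FC ψ z = 0 → |z.im| ≤ Δ) (k : ℕ) :
    GoodK (fun s => Real.cosh (a * s) ^ k * ψ s) ∧
    ∀ z, FC (fun s => Real.cosh (a * s) ^ k * ψ s) z = 0 → |z.im| ≤ √(Δ ^ 2 - k * a ^ 2) := by
  induction k with
  | zero => simpa [Real.sqrt_sq hΔ] using And.intro h hz
  | succ k ih =>
    obtain ⟨ih1, ih2⟩ := ih
    have e : (fun s => Real.cosh (a * s) ^ (k + 1) * ψ s) =
      fun s => Real.cosh (a * s) * (Real.cosh (a * s) ^ k * ψ s) := by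
      ext s; ring
    rw [e]
    refine ⟨ih1.mul_cosh a, fun z hz => ?_⟩
    refine (FC_cosh_strip ih1 a ha _ ih2 z hz).trans ?_
    rcases le_total 0 (Δ ^ 2 - k * a ^ 2) with h1 | h1
    · rw [Real.sq_sqrt h1]
      apply Real.sqrt_le_sqrt
      push_cast
      linarith
    · rw [Real.sqrt_eq_zero_of_nonpos h1, Real.sqrt_eq_zero_of_nonpos (by nlinarith)]
      exact Real.sqrt_nonneg _

theorem cosh_lower (x : ℝ) : 1 + x ^ 2 / 2 ≤ Real.cosh x := by
  have h1 : Real.cosh x = 1 + 2 * Real.sinh (x / 2) ^ 2 := by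
    have h := Real.cosh_two_mul (x / 2)
    have h' := Real.cosh_sq (x / 2)
    rw [mul_div_cancel₀ _ (two_ne_zero)] at h
    rw [h, h']; ring
  have h2 : (x / 2) ^ 2 ≤ Real.sinh (x / 2) ^ 2 := by
    rcases le_total 0 (x / 2) with h | h
    · have := Real.self_le_sinh_iff.2 h
      gcongr
    · have := Real.sinh_le_self_iff.2 h
      nlinarith
  rw [h1]; nlinarith

theorem cosh_pow_tendsto (τ : ℝ) (hτ : 0 ≤ τ) (s : ℝ) :
    Tendsto (fun n : ℕ => Real.cosh (√(2 * τ / n) * s) ^ n) atTop (𝓝 (Real.exp (τ * s ^ 2))) := by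
  have hlow := Real.tendsto_one_add_div_pow_exp (τ * s ^ 2)
  refine tendsto_of_tendsto_of_tendsto_of_le_of_le hlow tendsto_const_nhds ?_ ?_
  · intro n
    simp only
    have h1 := cosh_lower (√(2 * τ / n) * s)
    rw [mul_pow, Real.sq_sqrt (by positivity)] at h1
    have e : 1 + τ * s ^ 2 / n = 1 + 2 * τ / n * s ^ 2 / 2 := by ring
    rw [e]
    exact pow_le_pow_left₀ (by positivity) h1 n
  · intro n
    simp only
    have h1 := Real.cosh_le_exp_half_sq (√(2 * τ / n) * s)
    rw [mul_pow, Real.sq_sqrt (by positivity)] at h1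
    calc _ ≤ Real.exp (2 * τ / n * s ^ 2 / 2) ^ n :=
          pow_le_pow_left₀ (Real.cosh_pos _).le h1 n
      _ ≤ Real.exp (τ * s ^ 2) := by
          rw [← Real.exp_nat_mul]
          refine Real.exp_le_exp.2 ?_
          rcases Nat.eq_zero_or_pos n with rfl | hn
          · simp; positivity
          · have : (0 : ℝ) < n := by exact_mod_cast hn
            refine le_of_eq ?_
            field_simp

theorem deBruijn {ψ : ℝ → ℝ} (h : GoodK ψ) (Δ : ℝ) (hΔ : 0 ≤ Δ)
    (hz : ∀ z, FC ψ z = 0 → |z.im| ≤ Δ) (τ : ℝ) (hτ : 0 < τ) (z : ℂ)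
    (h0 : FC (fun s => Real.exp (τ * s ^ 2) * ψ s) z = 0) : |z.im| ≤ √(Δ ^ 2 - 2 * τ) := by
  have ha : ∀ n : ℕ, 0 < √(2 * τ / (n + 1 : ℕ)) := fun n => Real.sqrt_pos.2 (by positivity)
  have hcs := fun n : ℕ => FC_cosh_pow_strip h _ (ha n) Δ hΔ hz (n + 1)
  refine strip_limit (fun n : ℕ => FC (fun s => Real.cosh (√(2 * τ / (n + 1 : ℕ)) * s) ^ (n + 1) * ψ s))
    (fun n => FC_nice (hcs n).1) _ (Real.sqrt_nonneg _) (Eventually.of_forall fun n w hw => ?_)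
    _ (FC_nice (h.mul_exp τ)) ?_ z h0
  · have := (hcs n).2 w hw
    rw [Real.sq_sqrt (by positivity)] at this
    have e : ((n + 1 : ℕ) : ℝ) * (2 * τ / (n + 1 : ℕ)) = 2 * τ := by
      have : ((n + 1 : ℕ) : ℝ) ≠ 0 := by positivity
      field_simp
    rwa [e] at this
  · intro w
    have hi := FC_integrable (h.mul_exp τ) w
    refine tendsto_integral_of_dominated_convergence _
      (fun n => (FC_integrable (hcs n).1 w).aestronglyMeasurable) hi.norm ?_ ?_
    · intro n
      refine (ae_restrict_iff' measurableSet_Ioi).2 (Eventually.of_forall fun s hs => ?_)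
      have hp := h.pos s hs
      rw [norm_mul, norm_mul, norm_real, norm_real]
      refine mul_le_mul_of_nonneg_right ?_ (norm_nonneg _)
      have h1 := Real.cosh_pos (√(2 * τ / (n + 1 : ℕ)) * s)
      rw [Real.norm_of_nonneg (by positivity), Real.norm_of_nonneg (by positivity)]
      refine mul_le_mul_of_nonneg_right ?_ hp.le
      have h2 := Real.cosh_le_exp_half_sq (√(2 * τ / (n + 1 : ℕ)) * s)
      rw [mul_pow, Real.sq_sqrt (by positivity)] at h2
      calc _ ≤ Real.exp (2 * τ / (n + 1 : ℕ) * s ^ 2 / 2) ^ (n + 1) :=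
            pow_le_pow_left₀ h1.le h2 _
        _ = Real.exp (τ * s ^ 2) := by
          rw [← Real.exp_nat_mul]
          congr 1
          have : ((n + 1 : ℕ) : ℝ) ≠ 0 := by positivity
          field_simp
    · refine Eventually.of_forall fun s => ?_
      have h1 := (cosh_pow_tendsto τ hτ.le s).comp (tendsto_add_atTop_nat 1)
      have h2 := (h1.mul_const (ψ s))
      exact ((Complex.continuous_ofReal.tendsto _).comp h2).mul_const (cos (w * s))

end Part4

section Part5
open Complex Filter Topology Set Metric MeasureTheory

theorem cos_shift2 (j : ℕ) (w : ℂ) :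
    cos (w + ((j + 2 : ℕ) : ℂ) * (Real.pi / 2 : ℝ)) = -cos (w + j * (Real.pi / 2 : ℝ)) := by
  have : w + ((j + 2 : ℕ) : ℂ) * (Real.pi / 2 : ℝ) =
    (w + j * (Real.pi / 2 : ℝ)) + Real.pi := by push_cast; ring
  rw [this, Complex.cos_add_pi]

/-- the heat-flow deformation of the kernel -/
noncomputable def KT (φ : ℝ → ℝ) (t : ℝ) : ℝ → ℝ := fun s => Real.exp (t * s ^ 2) * φ s

theorem GoodK.kt {φ : ℝ → ℝ} (h : GoodK φ) (t : ℝ) : GoodK (KT φ t) := h.mul_exp t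

theorem GJ_t_hasDerivAt {φ : ℝ → ℝ} (h : GoodK φ) (j : ℕ) (z : ℂ) (t : ℝ) :
    HasDerivAt (fun t : ℝ => GJ (KT φ t) j z) (-(GJ (KT φ t) (j + 2) z)) t := by
  have key := hasDerivAt_integral_of_dominated_loc_of_deriv_le (μ := volume.restrict (Ioi (0 : ℝ)))
    (F := fun t s => ((KT φ t s : ℝ) : ℂ) * ((s : ℂ) ^ j * cos (z * s + j * (Real.pi / 2 : ℝ))))
    (F' := fun t s => -(((KT φ t s : ℝ) : ℂ) * ((s : ℂ) ^ (j + 2) *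
      cos (z * s + ((j + 2 : ℕ) : ℂ) * (Real.pi / 2 : ℝ)))))
    (x₀ := t) (s := ball t 1)
    (bound := fun s => Real.exp (2 * (j + 2 : ℕ) + ((j + 2 : ℕ) + ‖z‖) ^ 2) *
      (φ s * Real.exp ((t + 2) * s ^ 2)))
    (ball_mem_nhds t one_pos)
    (Eventually.of_forall fun w => (GJ_integrable (h.mul_exp w) j z).aestronglyMeasurable)
    (GJ_integrable (h.mul_exp t) j z) (GJ_integrable (h.mul_exp t) (j + 2) z).aestronglyMeasurable.neg ?_
    ((h.int (t + 2)).const_mul _) ?_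
  · have := key.2
    rw [integral_neg] at this
    exact this
  · refine (ae_restrict_iff' measurableSet_Ioi).2 (Eventually.of_forall fun s hs w hw => ?_)
    have hp := h.pos s hs
    have hw' : w ≤ t + 1 := by
      have h1 : |w - t| < 1 := by simpa [Real.dist_eq] using hw
      linarith [(abs_lt.1 h1).2]
    have hb := GJ_bound (j + 2) z _ le_rfl s hs
    have hk : KT φ w s ≤ Real.exp ((t + 1) * s ^ 2) * φ s := by
      unfold KT
      gcongr
    have hk0 : 0 < KT φ w s := (h.mul_exp w).pos s hs
    rw [norm_neg, norm_mul, norm_real, Real.norm_of_nonneg hk0.le]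
    refine (mul_le_mul hk hb (norm_nonneg _) (by positivity)).trans (le_of_eq ?_)
    have e : Real.exp ((t + 2) * s ^ 2) = Real.exp ((t + 1) * s ^ 2) * Real.exp (1 * s ^ 2) := by
      rw [← Real.exp_add]
      congr 1
      ring
    rw [e]
    generalize Real.exp ((t + 1) * s ^ 2) = A
    ring
  · refine Eventually.of_forall fun s w _ => ?_
    have h1 : HasDerivAt (fun w : ℝ => KT φ w s) (Real.exp (w * s ^ 2) * s ^ 2 * φ s) w := by
      have := (((hasDerivAt_id w).mul_const (s ^ 2)).exp).mul_const (φ s)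
      simp only [id, one_mul] at this
      exact this
    have h2 := (h1.ofReal_comp).mul_const ((s : ℂ) ^ j * cos (z * s + j * (Real.pi / 2 : ℝ)))
    convert! h2 using 1
    rw [cos_shift2, KT]
    push_cast
    ring

theorem GJ_t_re {φ : ℝ → ℝ} (h : GoodK φ) (j : ℕ) (z : ℂ) (t : ℝ) :
    HasDerivAt (fun t : ℝ => (GJ (KT φ t) j z).re) (-(GJ (KT φ t) (j + 2) z).re) t := by
  have := (Complex.reCLM.hasFDerivAt.comp_hasDerivAt t (GJ_t_hasDerivAt h j z t))
  rw [reCLM_apply, neg_re] at this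
  exact this

theorem GJ_real {ψ : ℝ → ℝ} (j : ℕ) (x : ℝ) : (GJ ψ j x).im = 0 := by
  rw [← Complex.conj_eq_iff_im, GJ, ← integral_conj]
  congr 1
  ext s
  simp only [map_mul, map_pow, conj_ofReal, ← Complex.cos_conj, map_add, map_natCast]

theorem FC_strip_real {φ : ℝ → ℝ} (h : GoodK φ) (t t' : ℝ) (htt : t < t')
    (hz : ∀ z, FC (KT φ t) z = 0 → z.im = 0) (z : ℂ) (h0 : FC (KT φ t') z = 0) : z.im = 0 := by
  have e : KT φ t' = fun s => Real.exp ((t' - t) * s ^ 2) * KT φ t s := by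
    ext s
    rw [KT, KT, ← mul_assoc, ← Real.exp_add]
    ring_nf
  rw [e] at h0
  have := deBruijn (h.mul_exp t) 0 le_rfl (fun z hz' => by rw [hz z hz', abs_zero]) (t' - t)
    (sub_pos.2 htt) z h0
  rw [Real.sqrt_eq_zero_of_nonpos (by linarith)] at this
  exact abs_nonpos_iff.1 this

theorem exists_deriv_ne {f : ℂ → ℂ} (hd : Differentiable ℂ f) (h0 : f 0 ≠ 0) (x : ℂ) :
    ∃ m : ℕ, deriv^[m] f x ≠ 0 := by
  by_contra! hcon
  apply h0
  have han : AnalyticOnNhd ℂ f univ := fun z _ => hd.analyticAt z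
  have hev : f =ᶠ[𝓝 x] 0 := by
    obtain ⟨p, hp⟩ := hd.analyticAt x
    have hp0 : p = 0 := by
      have := hp.eq_formalMultilinearSeries (hd.analyticAt x).hasFPowerSeriesAt
      rw [this]
      ext n
      simp [iteratedDeriv_eq_iterate, hcon]
    rw [hp0] at hp
    exact hp.eventually_hasSum_sub.mono fun z hz => (hz.unique (by simp) : f z = 0)
  exact han.eqOn_zero_of_preconnected_of_eventuallyEq_zero isPreconnected_univ (mem_univ x) hev
    (mem_univ 0)

theorem part_one {φ : ℝ → ℝ} (h : GoodK φ) (t₀ x : ℝ)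
    (h0 : GJ (KT φ t₀) 0 x = 0) (h1 : GJ (KT φ t₀) 1 x = 0) (t : ℝ)
    (hz : ∀ z, FC (KT φ t) z = 0 → z.im = 0) : t₀ ≤ t := by
  by_contra! hlt
  have hN := fun t => FC_nice (h.kt t)
  obtain ⟨m, hm⟩ := exists_deriv_ne (hN t₀).diff (hN t₀).ne0 x
  have hex : ∃ m, GJ (KT φ t₀) m x ≠ 0 := ⟨m, by rw [← FC_iter (h.kt t₀)]; exact hm⟩
  classical
  have hs := Nat.find_spec hex
  have hmin : ∀ k < Nat.find hex, GJ (KT φ t₀) k x = 0 := fun k hk => by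
    simpa using Nat.find_min hex hk
  obtain ⟨k, hk⟩ : ∃ k, Nat.find hex = k + 2 := by
    rcases hq : Nat.find hex with _ | _ | k
    · rw [hq] at hs; exact absurd h0 hs
    · rw [hq] at hs; exact absurd h1 hs
    · exact ⟨k, rfl⟩
  rw [hk] at hs hmin
  have g0 := hmin k (by omega)
  have g1 := hmin (k + 1) (by omega)
  have g2 : (GJ (KT φ t₀) (k + 2) x).re ≠ 0 := fun hre =>
    hs (Complex.ext hre (GJ_real _ _))
  set D : ℝ → ℝ := fun t => (GJ (KT φ t) (k + 1) x).re ^ 2 -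
    (GJ (KT φ t) k x).re * (GJ (KT φ t) (k + 2) x).re with hD
  have hDnn : ∀ t', t < t' → 0 ≤ D t' := by
    intro t' ht'
    have := laguerre_nice _ (hN t') (FC_strip_real h t t' ht' hz) k x
    rw [FC_iter (h.kt t'), FC_iter (h.kt t'), FC_iter (h.kt t')] at this
    exact this
  have hD0 : D t₀ = 0 := by simp [hD, g0, g1]
  have hDd : HasDerivAt D ((GJ (KT φ t₀) (k + 2) x).re ^ 2) t₀ := by
    have := ((GJ_t_re h (k + 1) x t₀).pow 2).sub
      ((GJ_t_re h k x t₀).mul (GJ_t_re h (k + 2) x t₀))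
    convert! this using 1
    simp [g0, g1]
    ring
  have hpos : 0 < (GJ (KT φ t₀) (k + 2) x).re ^ 2 := by positivity
  have hslope := hasDerivAt_iff_tendsto_slope.1 hDd
  have hle := hslope.mono_left (nhdsWithin_mono t₀ (s := Iio t₀) (fun a ha => ne_of_lt ha))
  have e1 := hle.eventually (lt_mem_nhds hpos)
  have e2 : ∀ᶠ a in 𝓝[<] t₀, t < a := nhdsWithin_le_nhds (lt_mem_nhds hlt)
  obtain ⟨a, ⟨ha1, ha2⟩, ha3⟩ := ((e1.and e2).and self_mem_nhdsWithin).exists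
  have ha3 : a < t₀ := ha3
  have := hDnn a ha2
  rw [slope_def_field, hD0] at ha1
  have : (D a - 0) / (a - t₀) ≤ 0 := div_nonpos_of_nonneg_of_nonpos (by linarith) (by linarith)
  linarith

end Part5

section Part6
open Complex Filter Topology Set Metric MeasureTheory

/-- frequencies -/
noncomputable def qn (n : ℕ) : ℝ := Real.pi * ((n : ℝ) + 1) ^ 2

theorem qn_ge (n : ℕ) : Real.pi ≤ qn n := by
  have : (1 : ℝ) ≤ ((n : ℝ) + 1) ^ 2 := by nlinarith [(Nat.cast_nonneg n : (0 : ℝ) ≤ n)]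
  unfold qn
  nlinarith [Real.pi_pos]

theorem qn_pos (n : ℕ) : 0 < qn n := Real.pi_pos.trans_le (qn_ge n)

theorem qn_one (n : ℕ) : 1 ≤ qn n := by linarith [qn_ge n, Real.pi_gt_three]

theorem q_summable (j : ℕ) (a : ℝ) (ha : 0 < a) :
    Summable fun n => qn n ^ j * Real.exp (-qn n * a) := by
  have h1 := (summable_nat_add_iff 1).2 (Real.summable_pow_mul_exp_neg_nat_mul (2 * j) ha)
  refine Summable.of_nonneg_of_le (fun n => by have := qn_pos n; positivity) (fun n => ?_)
    (h1.mul_left (Real.pi ^ j))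
  have e : qn n ^ j = Real.pi ^ j * ((n + 1 : ℕ) : ℝ) ^ (2 * j) := by
    rw [qn, mul_pow, pow_mul]; push_cast; rfl
  rw [e, mul_assoc]
  gcongr _ * (_ * Real.exp ?_)
  have : ((n + 1 : ℕ) : ℝ) ≤ qn n := by
    have h3 := Real.pi_gt_three
    unfold qn
    push_cast
    nlinarith [(Nat.cast_nonneg n : (0 : ℝ) ≤ n)]
  nlinarith

/-- theta-like series -/
noncomputable def gj (j : ℕ) (u : ℝ) : ℝ := ∑' n, qn n ^ j * Real.exp (-qn n * u)

theorem gj_hasDerivAt (j : ℕ) (u : ℝ) (hu : 0 < u) : HasDerivAt (gj j) (-gj (j + 1) u) u := by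
  have h := hasDerivAt_tsum_of_isPreconnected (t := Ioi (u / 2))
    (g := fun n u => qn n ^ j * Real.exp (-qn n * u))
    (g' := fun n u => -(qn n ^ (j + 1) * Real.exp (-qn n * u)))
    (q_summable (j + 1) (u / 2) (by positivity)) isOpen_Ioi isPreconnected_Ioi
    (fun n y _ => ?_) (fun n y hy => ?_) (y₀ := u) (by simp; linarith)
    (q_summable j u hu) (y := u) (by simp; linarith)
  · rw [tsum_neg] at h
    exact h
  · have h1 : HasDerivAt (fun u => -qn n * u) (-qn n) y := by
      simpa using (hasDerivAt_id y).const_mul (-qn n)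
    convert! (h1.exp).const_mul (qn n ^ j) using 1
    ring
  · have hp := qn_pos n
    have hy : u / 2 < y := hy
    rw [norm_neg, Real.norm_of_nonneg (by positivity)]
    gcongr ?_ * Real.exp ?_
    nlinarith

theorem phi_summable (s : ℝ) : HasSum (fun n : ℕ => Real.pi * ((n : ℝ) + 1) ^ 2 *
    (2 * Real.pi * ((n : ℝ) + 1) ^ 2 * Real.exp (4 * s) - 3) *
    Real.exp (5 * s - Real.pi * ((n : ℝ) + 1) ^ 2 * Real.exp (4 * s)))
    (2 * Real.exp (9 * s) * gj 2 (Real.exp (4 * s)) - 3 * Real.exp (5 * s) * gj 1 (Real.exp (4 * s))) := by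
  have h2 := ((q_summable 2 _ (Real.exp_pos (4 * s))).hasSum.mul_left (2 * Real.exp (9 * s)))
  have h1 := ((q_summable 1 _ (Real.exp_pos (4 * s))).hasSum.mul_left (3 * Real.exp (5 * s)))
  convert! h2.sub h1 using 1
  ext n
  rw [show 2 * Real.pi * ((n : ℝ) + 1) ^ 2 = 2 * qn n by unfold qn; ring,
    show Real.pi * ((n : ℝ) + 1) ^ 2 = qn n from rfl, sub_eq_add_neg, sub_eq_add_neg,
    Real.exp_add, show 9 * s = 4 * s + 5 * s by ring, Real.exp_add, ← neg_mul]
  ring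

theorem phi_eq (s : ℝ) : jacobiPhi s = 2 * Real.exp (9 * s) * gj 2 (Real.exp (4 * s)) -
    3 * Real.exp (5 * s) * gj 1 (Real.exp (4 * s)) := (phi_summable s).tsum_eq

theorem gj_cont (j : ℕ) : Continuous fun s => gj j (Real.exp (4 * s)) := by
  rw [continuous_iff_continuousAt]
  intro s
  exact ContinuousAt.comp (f := fun s => Real.exp (4 * s)) (gj_hasDerivAt j _ (Real.exp_pos _)).continuousAt
    (by fun_prop)

theorem phi_cont : Continuous jacobiPhi := by
  have e : jacobiPhi = _ := funext phi_eq
  rw [e]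
  have := gj_cont 1
  have := gj_cont 2
  fun_prop

theorem gj_nonneg (j : ℕ) (u : ℝ) : 0 ≤ gj j u :=
  tsum_nonneg fun n => by have := qn_pos n; positivity

theorem gj_decay (j : ℕ) (u : ℝ) (hu : 1 ≤ u) : gj j u ≤ Real.exp (1 - u) * gj j 1 := by
  unfold gj
  rw [← tsum_mul_left]
  refine (q_summable j u (by linarith)).tsum_le_tsum (fun n => ?_) ((q_summable j 1 one_pos).mul_left _)
  have hp := qn_one n
  calc _ ≤ qn n ^ j * Real.exp ((1 - u) + (-qn n * 1)) := by
        gcongr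
        nlinarith
    _ = _ := by rw [Real.exp_add]; ring

theorem phi_good : GoodK jacobiPhi where
  cont := phi_cont.continuousOn
  pos s hs := by
    rw [phi_eq, ← (phi_summable s).tsum_eq]
    have key : ∀ n : ℕ, 0 < Real.pi * ((n : ℝ) + 1) ^ 2 *
      (2 * Real.pi * ((n : ℝ) + 1) ^ 2 * Real.exp (4 * s) - 3) *
      Real.exp (5 * s - Real.pi * ((n : ℝ) + 1) ^ 2 * Real.exp (4 * s)) := by
      intro n
      have h1 := qn_ge n
      have h3 := Real.pi_gt_three
      have h2 : 1 ≤ Real.exp (4 * s) := Real.one_le_exp (by linarith)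
      rw [show 2 * Real.pi * ((n : ℝ) + 1) ^ 2 = 2 * qn n by unfold qn; ring,
        show Real.pi * ((n : ℝ) + 1) ^ 2 = qn n from rfl]
      have h4 : 0 < 2 * qn n * Real.exp (4 * s) - 3 := by nlinarith
      have := qn_pos n
      positivity
    exact (phi_summable s).summable.tsum_pos (fun n => (key n).le) 0 (key 0)
  decay k := by
    set K := |k| + 9 with hK
    have hK9 : 9 ≤ K := by have := abs_nonneg k; linarith
    refine ⟨2 * Real.exp (1 + 9 + K ^ 3) * gj 2 1, fun s hs => ?_⟩
    have h1 : 1 ≤ Real.exp (4 * s) := Real.one_le_exp (by linarith)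
    have h2 := gj_decay 2 _ h1
    have h3 := gj_nonneg 1 (Real.exp (4 * s))
    have h4 := gj_nonneg 2 1
    rw [phi_eq]
    have h5 : s ^ 3 ≤ Real.exp (4 * s) := by
      have := Real.pow_div_factorial_le_exp (4 * s) (by linarith) 3
      norm_num [Nat.factorial] at this
      have : 0 < s ^ 3 := by positivity
      nlinarith
    have h6 : K * s ^ 2 ≤ K ^ 3 + s ^ 3 := by
      rcases le_total s K with h | h
      · have : K * s ^ 2 ≤ K * K ^ 2 := by gcongr
        nlinarith [pow_pos hs 3]
      · have : K * s ^ 2 ≤ s * s ^ 2 := by gcongr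
        nlinarith [pow_pos (by linarith : 0 < K) 3]
    have h7 : 9 * s + (1 - Real.exp (4 * s)) ≤ (1 + 9 + K ^ 3) + -k * s ^ 2 := by
      have : k * s ^ 2 ≤ |k| * s ^ 2 := by gcongr; exact le_abs_self k
      nlinarith
    calc _ ≤ 2 * Real.exp (9 * s) * (Real.exp (1 - Real.exp (4 * s)) * gj 2 1) := by
          have : 0 ≤ 3 * Real.exp (5 * s) * gj 1 (Real.exp (4 * s)) := by positivity
          have h8 : 2 * Real.exp (9 * s) * gj 2 (Real.exp (4 * s)) ≤
            2 * Real.exp (9 * s) * (Real.exp (1 - Real.exp (4 * s)) * gj 2 1) := by gcongr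
          linarith
      _ = 2 * Real.exp (9 * s + (1 - Real.exp (4 * s))) * gj 2 1 := by rw [Real.exp_add]; ring
      _ ≤ 2 * Real.exp ((1 + 9 + K ^ 3) + -k * s ^ 2) * gj 2 1 := by gcongr
      _ = _ := by rw [Real.exp_add]; ring

theorem theta_func (u : ℝ) (hu : 0 < u) :
    1 + 2 * gj 0 u = 1 / u ^ (1 / 2 : ℝ) * (1 + 2 * gj 0 (1 / u)) := by
  have key : ∀ a : ℝ, 0 < a → ∑' n : ℤ, Real.exp (-Real.pi * a * (n : ℝ) ^ 2) = 1 + 2 * gj 0 a := by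
    intro a ha
    have h := (q_summable 0 a ha).hasSum
    have h1 : HasSum (fun n : ℕ => Real.exp (-Real.pi * a * (((n : ℤ) + 1 : ℤ) : ℝ) ^ 2)) (gj 0 a) := by
      convert! h using 1
      ext n
      simp only [pow_zero, one_mul, qn]
      congr 1
      push_cast
      ring
    have h2 : HasSum (fun n : ℕ => Real.exp (-Real.pi * a * ((-((n : ℤ) + 1) : ℤ) : ℝ) ^ 2)) (gj 0 a) := by
      convert! h1 using 1
      ext n
      push_cast
      ring_nf
    have h3 := HasSum.of_add_one_of_neg_add_one (f := fun n : ℤ => Real.exp (-Real.pi * a * (n : ℝ) ^ 2)) h1 h2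
    rw [h3.tsum_eq]
    simp
    ring
  have h := Real.tsum_exp_neg_mul_int_sq hu
  rw [key u hu] at h
  rw [h, ← key _ (by positivity)]
  congr 1
  refine tsum_congr fun n => ?_
  congr 1
  ring

theorem gjc_deriv (j : ℕ) (s : ℝ) : HasDerivAt (fun s => gj j (Real.exp (4 * s)))
    (-4 * Real.exp (4 * s) * gj (j + 1) (Real.exp (4 * s))) s := by
  have h1 : HasDerivAt (fun s : ℝ => Real.exp (4 * s)) (Real.exp (4 * s) * 4) s := by
    simpa using ((hasDerivAt_id s).const_mul 4).exp
  convert! (gj_hasDerivAt j _ (Real.exp_pos (4 * s))).comp s h1 using 1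
  ring

theorem phi_even (s : ℝ) : jacobiPhi (-s) = jacobiPhi s := by
  set A : ℝ → ℝ := fun s => Real.exp s * (1 + 2 * gj 0 (Real.exp (4 * s))) with hA
  have hAe : ∀ s, A (-s) = A s := by
    intro s
    have h := theta_func (Real.exp (4 * s)) (Real.exp_pos _)
    rw [← Real.exp_mul, one_div, one_div, one_div, ← Real.exp_neg, ← Real.exp_neg] at h
    simp only [hA]
    rw [h, ← mul_assoc, ← Real.exp_add]
    ring_nf
  set B : ℝ → ℝ := fun s => A s - 8 * (Real.exp s * (Real.exp (4 * s) * gj 1 (Real.exp (4 * s)))) with hB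
  have he : ∀ s, HasDerivAt (fun s : ℝ => Real.exp (4 * s)) (Real.exp (4 * s) * 4) s := fun s => by
    simpa using ((hasDerivAt_id s).const_mul 4).exp
  have hA' : ∀ s, HasDerivAt A (B s) s := by
    intro s
    convert! (Real.hasDerivAt_exp s).mul (((gjc_deriv 0 s).const_mul 2).const_add 1) using 1
    simp only [hB, hA]
    ring
  have hB' : ∀ s, HasDerivAt B (A s + 16 * jacobiPhi s) s := by
    intro s
    convert! (hA' s).sub (((Real.hasDerivAt_exp s).mul ((he s).mul (gjc_deriv 1 s))).const_mul 8) using 1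
    simp only [hB, hA, phi_eq, Pi.mul_apply]
    rw [show 9 * s = s + 4 * s + 4 * s by ring, show 5 * s = s + 4 * s by ring]
    simp only [Real.exp_add]
    ring
  have hBo : ∀ s, B (-s) = -B s := by
    intro s
    have h1 := (hA' (-s)).comp s (hasDerivAt_neg s)
    have h2 : (A ∘ fun s => -s) = A := funext hAe
    have h3 : A ∘ Neg.neg = A := funext hAe
    rw [h3] at h1
    have := h1.unique (hA' s)
    linarith
  have h1 := (hB' (-s)).comp s (hasDerivAt_neg s)
  have h3 : B ∘ Neg.neg = fun s => -B s := funext hBo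
  rw [h3] at h1
  have := h1.unique (hB' s).neg
  have := hAe s
  linarith

end Part6

section Part7
open Complex Filter Topology Set Metric MeasureTheory

theorem qn_cpow (n : ℕ) (ρ : ℂ) : (qn n : ℂ) ^ (-ρ) =
    (Real.pi : ℂ) ^ (-ρ) * (1 / (n + 1 : ℂ) ^ (2 * ρ)) := by
  have h1 : (0 : ℝ) ≤ (n : ℝ) + 1 := by positivity
  rw [qn, ofReal_mul, mul_cpow_ofReal_nonneg Real.pi_pos.le (by positivity)]
  congr 1
  have hne : (((n : ℝ) + 1 : ℝ) : ℂ) ≠ 0 := by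
    rw [Complex.ofReal_ne_zero]; positivity
  rw [ofReal_pow, pow_two, mul_cpow_ofReal_nonneg h1 h1, ← cpow_add _ _ hne, one_div, ← cpow_neg]
  push_cast
  ring_nf

theorem mellin_gj (j : ℕ) (σ : ℂ) (hσ : 1 / 2 < (σ - j).re) :
    mellin (fun u => (gj j u : ℂ)) σ =
      Gamma σ * ((Real.pi : ℂ) ^ (-(σ - j)) * riemannZeta (2 * (σ - j))) := by
  have hre : (σ - j).re = σ.re - j := by simp
  have hj : (0 : ℝ) ≤ j := by positivity
  have h := hasSum_mellin (a := fun n => ((qn n : ℂ)) ^ j) (p := qn)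
    (F := fun u => (gj j u : ℂ)) (s := σ) (fun n => Or.inr (qn_pos n)) (by linarith) ?_ ?_
  · rw [← h.tsum_eq, zeta_eq_tsum_one_div_nat_add_one_cpow (by simp at hσ ⊢; linarith),
      ← tsum_mul_left, ← tsum_mul_left]
    refine tsum_congr fun n => ?_
    rw [← qn_cpow, mul_div_assoc]
    congr 1
    have hne : (qn n : ℂ) ≠ 0 := Complex.ofReal_ne_zero.2 (qn_pos n).ne'
    rw [neg_sub, cpow_sub _ _ hne, cpow_natCast]
  · intro t ht
    have h5 : HasSum (fun n => qn n ^ j * Real.exp (-qn n * t)) (gj j t) := (q_summable j t ht).hasSum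
    have h6 := Complex.hasSum_ofReal.2 h5
    push_cast at h6
    push_cast
    exact h6
  · have hs : Summable fun n : ℕ => Real.pi ^ (-(σ - j).re) * (1 / ((n + 1 : ℕ) : ℝ) ^ (2 * (σ - j).re)) := by
      refine Summable.mul_left _ ?_
      exact (summable_nat_add_iff 1).2 (Real.summable_one_div_nat_rpow.2 (by linarith))
    refine hs.congr fun n => ?_
    have hp := qn_pos n
    rw [norm_pow, norm_real, Real.norm_of_nonneg hp.le, ← Real.rpow_natCast, ← Real.rpow_sub hp,
      qn, Real.mul_rpow Real.pi_pos.le (by positivity), hre, neg_sub]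
    congr 1
    rw [one_div, ← Real.rpow_neg (by positivity), ← Real.rpow_natCast, ← Real.rpow_mul (by positivity)]
    push_cast
    ring_nf

theorem mellin_ne (j : ℕ) (σ : ℂ) (hσ : 1 / 2 < (σ - j).re) :
    mellin (fun u => (gj j u : ℂ)) σ ≠ 0 := by
  rw [mellin_gj j σ hσ]
  have hre : (σ - j).re = σ.re - j := by simp
  have hj : (0 : ℝ) ≤ j := by positivity
  refine mul_ne_zero (Gamma_ne_zero_of_re_pos (by linarith)) (mul_ne_zero ?_
    (riemannZeta_ne_zero_of_one_lt_re (by simp at hσ ⊢; linarith)))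
  rw [cpow_ne_zero_iff_of_exponent_ne_zero]
  · exact Complex.ofReal_ne_zero.2 Real.pi_pos.ne'
  · intro h
    rw [neg_eq_zero] at h
    rw [h] at hσ
    norm_num at hσ

theorem exp_subst (f : ℝ → ℂ) (σ : ℂ) (hf : mellin f σ ≠ 0) :
    Integrable (fun s : ℝ => exp (4 * σ * s) * f (Real.exp (4 * s))) ∧
    4 * ∫ s : ℝ, exp (4 * σ * s) * f (Real.exp (4 * s)) = mellin f σ := by
  have hd : ∀ x ∈ (univ : Set ℝ), HasDerivWithinAt (fun s : ℝ => Real.exp (4 * s)) (4 * Real.exp (4 * x)) univ x := by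
    intro x _
    have : HasDerivAt (fun s : ℝ => Real.exp (4 * s)) (4 * Real.exp (4 * x)) x := by
      simpa [mul_comm] using ((hasDerivAt_id x).const_mul 4).exp
    exact this.hasDerivWithinAt
  have hinj : InjOn (fun s : ℝ => Real.exp (4 * s)) univ := by
    intro a _ b _ hab
    have := Real.exp_injective hab
    linarith
  have him : (fun s : ℝ => Real.exp (4 * s)) '' univ = Ioi 0 := by
    ext y
    simp only [image_univ, mem_range, mem_Ioi]
    constructor
    · rintro ⟨x, rfl⟩; exact Real.exp_pos _
    · intro hy
      refine ⟨Real.log y / 4, ?_⟩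
      rw [mul_div_cancel₀ _ (by norm_num), Real.exp_log hy]
  have e : ∀ s : ℝ, |4 * Real.exp (4 * s)| • (((Real.exp (4 * s) : ℝ) : ℂ) ^ (σ - 1) • f (Real.exp (4 * s)))
      = 4 * (exp (4 * σ * s) * f (Real.exp (4 * s))) := by
    intro s
    rw [abs_of_pos (by positivity), smul_eq_mul, real_smul, cpow_def_of_ne_zero (by simp),
      ← Complex.ofReal_log (Real.exp_pos _).le, Real.log_exp]
    push_cast
    have : exp (4 * σ * s) = exp (4 * s) * exp (4 * s * (σ - 1)) := by
      rw [← Complex.exp_add]; ring_nf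
    rw [this]
    ring
  have hint : IntegrableOn (fun u : ℝ => (u : ℂ) ^ (σ - 1) • f u) (Ioi 0) := by
    by_contra hcon
    exact hf (integral_undef hcon)
  constructor
  · rw [← him, integrableOn_image_iff_integrableOn_abs_deriv_smul MeasurableSet.univ hd hinj] at hint
    simp only [e] at hint
    rw [integrableOn_univ] at hint
    simpa using hint.const_mul (1 / 4)
  · rw [mellin, ← him, integral_image_eq_integral_abs_deriv_smul MeasurableSet.univ hd hinj]
    simp only [e]
    rw [integral_const_mul, Measure.restrict_univ]

theorem phi_transform (w : ℂ) (hw : 1 < w.re) :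
    Integrable (fun s : ℝ => (jacobiPhi s : ℂ) * exp (w * s)) ∧
    ∫ s : ℝ, (jacobiPhi s : ℂ) * exp (w * s) ≠ 0 := by
  set σ : ℂ := w / 4 + 5 / 4 with hσ
  have hre : σ.re = w.re / 4 + 5 / 4 := by
    simp [hσ]
  have c1 : 1 / 2 < (σ - (1 : ℕ)).re := by simp [hre]; linarith
  have c2 : 1 / 2 < (σ + 1 - (2 : ℕ)).re := by simp [hre]; linarith
  obtain ⟨i1, v1⟩ := exp_subst _ _ (mellin_ne 1 σ c1)
  obtain ⟨i2, v2⟩ := exp_subst _ _ (mellin_ne 2 (σ + 1) c2)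
  have e : (fun s : ℝ => (jacobiPhi s : ℂ) * exp (w * s)) = fun s : ℝ =>
      2 * (exp (4 * (σ + 1) * s) * (gj 2 (Real.exp (4 * s)) : ℂ)) -
      3 * (exp (4 * σ * s) * (gj 1 (Real.exp (4 * s)) : ℂ)) := by
    ext s
    rw [phi_eq, show 4 * (σ + 1) * s = 9 * s + w * s by rw [hσ]; ring,
      show 4 * σ * s = 5 * s + w * s by rw [hσ]; ring, Complex.exp_add, Complex.exp_add]
    push_cast
    ring
  rw [e]
  refine ⟨(i2.const_mul 2).sub (i1.const_mul 3), ?_⟩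
  rw [integral_sub (i2.const_mul 2) (i1.const_mul 3), integral_const_mul, integral_const_mul]
  intro h0
  have hσ0 : σ ≠ 0 := by
    intro h; rw [h] at hre; simp at hre; linarith
  have hm := mellin_ne 1 σ c1
  rw [mellin_gj 1 σ c1] at hm v1
  rw [mellin_gj 2 _ c2, Complex.Gamma_add_one _ hσ0,
    show σ + 1 - ((2 : ℕ) : ℂ) = σ - ((1 : ℕ) : ℂ) by push_cast; ring] at v2
  set M := Gamma σ * ((Real.pi : ℂ) ^ (-(σ - (1 : ℕ))) * riemannZeta (2 * (σ - (1 : ℕ)))) with hM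
  have : (2 * σ - 3) * M = 0 := by
    rw [hM]
    rw [hM] at v1
    linear_combination 4 * h0 - 2 * v2 + 3 * v1
  rcases mul_eq_zero.1 this with h | h
  · have := congrArg Complex.re h
    simp [hre] at this
    linarith
  · exact hm h

theorem phi_strip_aux (z w : ℂ) (hw : w = z * I ∨ w = -(z * I)) (hre : 1 < w.re) : FC jacobiPhi z ≠ 0 := by
  obtain ⟨hi, hne⟩ := phi_transform w hre
  intro h0
  apply hne
  have hsplit : ∫ s : ℝ, (jacobiPhi s : ℂ) * exp (w * s) =
      (∫ s in Iic (0 : ℝ), (jacobiPhi s : ℂ) * exp (w * s)) +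
      ∫ s in Ioi (0 : ℝ), (jacobiPhi s : ℂ) * exp (w * s) := by
    rw [← compl_Iic, integral_add_compl measurableSet_Iic hi]
  have hneg : ∫ s in Iic (0 : ℝ), (jacobiPhi s : ℂ) * exp (w * s) =
      ∫ s in Ioi (0 : ℝ), (jacobiPhi s : ℂ) * exp (-(w * s)) := by
    have := integral_comp_neg_Ioi 0 (fun s : ℝ => (jacobiPhi s : ℂ) * exp (w * s))
    rw [neg_zero] at this
    rw [← this]
    simp only [phi_even, ofReal_neg, mul_neg]
  have hi2 : IntegrableOn (fun s : ℝ => (jacobiPhi s : ℂ) * exp (-(w * s))) (Ioi 0) := by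
    have := hi.comp_neg
    simp only [phi_even, ofReal_neg, mul_neg] at this
    exact this.integrableOn
  rw [hsplit, hneg, ← integral_add hi2 hi.integrableOn]
  have : ∀ s : ℝ, (jacobiPhi s : ℂ) * exp (-(w * s)) + (jacobiPhi s : ℂ) * exp (w * s) =
      2 * ((jacobiPhi s : ℂ) * cos (z * s)) := by
    intro s
    rw [Complex.cos]
    rcases hw with rfl | rfl
    · rw [show z * s * I = z * I * s by ring, show -(z * s) * I = -(z * I * s) by ring]
      ring
    · rw [show z * s * I = z * I * s by ring, show -(z * s) * I = -(z * I * s) by ring,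
        show -(-(z * I) * s) = z * I * s by ring, show -(z * I) * s = -(z * I * s) by ring]
      ring
  simp only [this]
  rw [integral_const_mul]
  have h0' : ∫ s in Ioi (0 : ℝ), (jacobiPhi s : ℂ) * cos (z * s) = 0 := h0
  rw [h0', mul_zero]

theorem phi_strip (z : ℂ) (h0 : FC jacobiPhi z = 0) : |z.im| ≤ 1 := by
  by_contra! h
  rcases lt_abs.1 h with h1 | h1
  · exact phi_strip_aux z _ (Or.inr rfl) (by simpa using h1) h0
  · exact phi_strip_aux z _ (Or.inl rfl) (by simpa using h1) h0

theorem half_mem (z : ℂ) (h0 : HtC (1 / 2) z = 0) : z.im = 0 := by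
  have := deBruijn phi_good 1 zero_le_one phi_strip (1 / 2) (by norm_num) z h0
  norm_num at this
  exact this

theorem Ht_eq (t x : ℝ) : Ht t x = (GJ (KT jacobiPhi t) 0 x).re := by
  have : GJ (KT jacobiPhi t) 0 x = ((Ht t x : ℝ) : ℂ) := by
    rw [← FC_eq, FC, Ht]
    have e : ∀ s : ℝ, ((KT jacobiPhi t s : ℝ) : ℂ) * cos (x * s) =
      ((Real.exp (t * s ^ 2) * jacobiPhi s * Real.cos (x * s) : ℝ) : ℂ) := by
      intro s; rw [KT]; push_cast; rfl
    simp only [e]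
    exact integral_ofReal
  rw [this, ofReal_re]

theorem double_zero_le (t₀ x₀ : ℝ) (h0 : Ht t₀ x₀ = 0) (h1 : deriv (Ht t₀) x₀ = 0) (t : ℝ)
    (hz : ∀ z : ℂ, HtC t z = 0 → z.im = 0) : t₀ ≤ t := by
  refine part_one phi_good t₀ x₀ ?_ ?_ t hz
  · exact Complex.ext (by rw [← Ht_eq, h0]; rfl) (GJ_real _ _)
  · have hd := (GJ_hasDerivAt (phi_good.kt t₀) 0 (x₀ : ℂ)).real_of_complex
    have e : Ht t₀ = fun x : ℝ => (GJ (KT jacobiPhi t₀) 0 x).re := funext (Ht_eq t₀)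
    rw [e, hd.deriv] at h1
    exact Complex.ext h1 (GJ_real _ _)

end Part7

/-- **Proposition 4.9.** If `H_{t₀}` has a multiple real zero, then `t₀ ≤ t` for every
`t` such that all zeros of `H_t` are real (i.e. `t₀ ≤ Λ`, the de Bruijn–Newman constant
`Λ = inf {t : all zeros of H_t are real}`).  In particular, if `t > Λ` then all real
zeros of `H_t` are simple. -/
theorem prop_4_9 (t₀ : ℝ)
    (hmult : ∃ x₀ : ℝ, Ht t₀ x₀ = 0 ∧ deriv (Ht t₀) x₀ = 0) :
    (∀ t : ℝ, (∀ z : ℂ, HtC t z = 0 → z.im = 0) → t₀ ≤ t) ∧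
    (∀ t : ℝ, sInf {s : ℝ | ∀ z : ℂ, HtC s z = 0 → z.im = 0} < t →
      ∀ x : ℝ, Ht t x = 0 → deriv (Ht t) x ≠ 0) := by
  obtain ⟨x₀, h0, h1⟩ := hmult
  refine ⟨fun t hz => double_zero_le t₀ x₀ h0 h1 t hz, fun t ht x hx hx' => ?_⟩
  have hne : {s : ℝ | ∀ z : ℂ, HtC s z = 0 → z.im = 0}.Nonempty := ⟨1 / 2, half_mem⟩
  obtain ⟨s, hs, hst⟩ := exists_lt_of_csInf_lt hne ht
  exact absurd (double_zero_le t x hx hx' s hs) (not_le.2 hst)
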